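/- arXiv:1807.01794 — 4 statements merged into one kernel-verified Lean document; each statement's English description precedes it below -/
import Mathlib

section
/- Along the subsequence n_k = 2^k k, the probability that the uniform random graph has property P has strictly positive lower limit: liminf_{k→∞} P(G(n_k,1/2) has property P) > 0. -/
open Filter Real

/-- A "configuration" in a graph `G`: two disjoint nonempty cliques `X₁, X₂` with no
edges between them, together with a vertex `x` outside both that is adjacent to every
vertex of `X₁ ∪ X₂`, such that every vertex outside `X₁ ∪ X₂` has a neighbor in `X₁`
and a neighbor in `X₂`. -/
def IsConfig {n : ℕ} (G : SimpleGraph (Fin n)) (X₁ X₂ : Finset (Fin n)) (x : Fin n) : Prop :=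
  X₁.Nonempty ∧ X₂.Nonempty ∧ Disjoint X₁ X₂ ∧
  x ∉ X₁ ∧ x ∉ X₂ ∧
  (∀ u ∈ X₁, ∀ v ∈ X₁, u ≠ v → G.Adj u v) ∧
  (∀ u ∈ X₂, ∀ v ∈ X₂, u ≠ v → G.Adj u v) ∧
  (∀ u ∈ X₁, ∀ v ∈ X₂, ¬ G.Adj u v) ∧
  (∀ u ∈ X₁, G.Adj x u) ∧ (∀ u ∈ X₂, G.Adj x u) ∧
  (∀ y : Fin n, y ∉ X₁ → y ∉ X₂ →
    (∃ u ∈ X₁, G.Adj y u) ∧ (∃ u ∈ X₂, G.Adj y u))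

/-- Property `P` of a graph: existence of a configuration. -/
def PropertyP {n : ℕ} (G : SimpleGraph (Fin n)) : Prop :=
  ∃ (X₁ X₂ : Finset (Fin n)) (x : Fin n), IsConfig G X₁ X₂ x

/-- The probability, under the uniform distribution on graphs on `{1, …, n}`,
of the set of graphs satisfying `Q`. -/
noncomputable def unifProb (n : ℕ) (Q : SimpleGraph (Fin n) → Prop) : ℝ :=
  (Nat.card {G : SimpleGraph (Fin n) // Q G} : ℝ) / 2 ^ (n.choose 2)

section Bits

variable {E : Type*}

/-- Membership in `A` depends only on the bits in `F`. -/
def DeterminedOn (A : Set (E → Bool)) (F : Finset E) : Prop :=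
  ∀ f g : E → Bool, (∀ e ∈ F, f e = g e) → f ∈ A → g ∈ A

/-- The assignments that agree with `g` on `F`. -/
def cylinder (F : Finset E) (g : E → Bool) : Set (E → Bool) := {f | ∀ e ∈ F, f e = g e}

lemma determinedOn_cylinder (F : Finset E) (g : E → Bool) : DeterminedOn (cylinder F g) F :=
  fun _ _ hff' hf e he => (hff' e he).symm.trans (hf e he)

variable [Fintype E]

/-- The probability of a set of bit assignments when the bits are independent and fair. -/
noncomputable def bitProb (A : Set (E → Bool)) : ℝ := A.ncard / 2 ^ Fintype.card E

lemma bitProb_nonneg (A : Set (E → Bool)) : 0 ≤ bitProb A := by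
  unfold bitProb; positivity

lemma bitProb_mono {A B : Set (E → Bool)} (h : A ⊆ B) : bitProb A ≤ bitProb B := by
  unfold bitProb
  gcongr
  exact Set.toFinite B

lemma bitProb_univ : bitProb (Set.univ : Set (E → Bool)) = 1 := by
  simp [bitProb, Set.ncard_univ, Nat.card_fun]

lemma bitProb_union_add_inter (A B : Set (E → Bool)) :
    bitProb (A ∪ B) + bitProb (A ∩ B) = bitProb A + bitProb B := by
  simp only [bitProb, ← add_div]
  congr 1
  exact_mod_cast Set.ncard_union_add_ncard_inter A B

lemma bitProb_union_le (A B : Set (E → Bool)) : bitProb (A ∪ B) ≤ bitProb A + bitProb B := by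
  linarith [bitProb_union_add_inter A B, bitProb_nonneg (A ∩ B)]

lemma bitProb_compl (A : Set (E → Bool)) : bitProb Aᶜ = 1 - bitProb A := by
  have h := bitProb_union_add_inter A Aᶜ
  have h0 : bitProb (∅ : Set (E → Bool)) = 0 := by simp [bitProb]
  rw [Set.union_compl_self, Set.inter_compl_self, bitProb_univ, h0] at h
  linarith

variable [DecidableEq E]

lemma bitProb_inter_of_disjoint {A B : Set (E → Bool)} {F H : Finset E}
    (hA : DeterminedOn A F) (hB : DeterminedOn B H) (hFH : Disjoint F H) :
    bitProb (A ∩ B) = bitProb A * bitProb B := by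
  have hcard : (A ∩ B).ncard * (Set.univ : Set (E → Bool)).ncard = A.ncard * B.ncard := by
    rw [← Set.ncard_prod, ← Set.ncard_prod]
    refine Set.ncard_congr (fun p _ => (F.piecewise p.1 p.2, F.piecewise p.2 p.1)) ?_ ?_ ?_
    · rintro ⟨f, g⟩ ⟨⟨hf, hf'⟩, -⟩
      refine ⟨hA f _ (fun e he => by simp [he]) hf, hB f _ (fun e he => ?_) hf'⟩
      simp [Finset.disjoint_right.1 hFH he]
    · rintro ⟨f, g⟩ ⟨f', g'⟩ - - h
      simp only [Prod.mk.injEq] at h ⊢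
      constructor <;> funext e <;> have h1 := congrFun h.1 e <;> have h2 := congrFun h.2 e <;>
        by_cases he : e ∈ F <;> simp_all
    · rintro ⟨f, g⟩ ⟨hf, hg⟩
      refine ⟨(F.piecewise f g, F.piecewise g f), ⟨⟨?_, ?_⟩, trivial⟩, ?_⟩
      · exact hA f _ (fun e he => by simp [he]) hf
      · exact hB g _ (fun e he => by simp [Finset.disjoint_right.1 hFH he]) hg
      · ext e <;> by_cases he : e ∈ F <;> simp [he]
  rw [Set.ncard_univ] at hcard
  have h2 : ((Nat.card (E → Bool) : ℕ) : ℝ) = 2 ^ Fintype.card E := by simp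
  have hcard' : ((A ∩ B).ncard : ℝ) * 2 ^ Fintype.card E = A.ncard * B.ncard := by
    rw [← h2]; exact_mod_cast hcard
  unfold bitProb
  field_simp
  linarith

lemma bitProb_inter_biInter {ι : Type*} [DecidableEq ι] (W : Finset ι) {A : Set (E → Bool)}
    {F : Finset E} {B : ι → Set (E → Bool)} {H : ι → Finset E} (hA : DeterminedOn A F)
    (hB : ∀ i ∈ W, DeterminedOn (B i) (H i)) (hFH : ∀ i ∈ W, Disjoint F (H i))
    (hH : ∀ i ∈ W, ∀ j ∈ W, i ≠ j → Disjoint (H i) (H j)) :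
    bitProb (A ∩ {f | ∀ i ∈ W, f ∈ B i}) = bitProb A * ∏ i ∈ W, bitProb (B i) := by
  induction W using Finset.induction_on with
  | empty => simp
  | insert i W hi ih =>
    have hset : A ∩ {f | ∀ j ∈ insert i W, f ∈ B j} = (A ∩ {f | ∀ j ∈ W, f ∈ B j}) ∩ B i := by
      ext f; simp; tauto
    have hdet : DeterminedOn (A ∩ {f | ∀ j ∈ W, f ∈ B j}) (F ∪ W.biUnion H) := by
      intro f g hfg hf
      refine ⟨hA f g (fun e he => hfg e (by simp [he])) hf.1, fun j hj => ?_⟩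
      refine hB j (by simp [hj]) f g (fun e he => hfg e ?_) (hf.2 j hj)
      exact Finset.mem_union_right _ (Finset.mem_biUnion.2 ⟨j, hj, he⟩)
    have hdisj : Disjoint (F ∪ W.biUnion H) (H i) := by
      rw [Finset.disjoint_union_left, Finset.disjoint_biUnion_left]
      refine ⟨hFH i (by simp), fun j hj => hH j (by simp [hj]) i (by simp) ?_⟩
      rintro rfl; exact hi hj
    rw [hset, bitProb_inter_of_disjoint hdet (hB i (by simp)) hdisj,
      ih (fun j hj => hB j (by simp [hj])) (fun j hj => hFH j (by simp [hj]))
        (fun a ha b hb => hH a (by simp [ha]) b (by simp [hb])), Finset.prod_insert hi]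
    ring

lemma bitProb_cylinder (F : Finset E) (g : E → Bool) :
    bitProb (cylinder F g) = (1 / 2 : ℝ) ^ F.card := by
  have hset : cylinder F g =
      (Fintype.piFinset (fun e => if e ∈ F then {g e} else Finset.univ) : Finset (E → Bool)) := by
    ext f
    simp only [cylinder, Set.mem_ofPred_eq, Finset.mem_coe, Fintype.mem_piFinset]
    refine forall_congr' fun e => ?_
    by_cases he : e ∈ F <;> simp [he]
  have hprod : ∀ e, (if e ∈ F then {g e} else Finset.univ : Finset Bool).card
      = if e ∈ F then 1 else 2 := by
    intro e; split_ifs <;> simp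
  have hcard : F.card + (Finset.univ.filter (fun e => e ∉ F)).card = Fintype.card E := by
    have := Finset.card_filter_add_card_filter_not (s := (Finset.univ : Finset E)) (fun e => e ∈ F)
    simpa using this
  rw [bitProb, hset, Set.ncard_coe_finset, Fintype.card_piFinset]
  simp only [hprod, Finset.prod_ite, Finset.prod_const, one_pow, one_mul]
  rw [← hcard]
  push_cast
  rw [pow_add, one_div, inv_pow]
  field_simp

/-- The second moment method for a family of events. -/
lemma sq_sum_bitProb_le {ι : Type*} (C : Finset ι) (A : ι → Set (E → Bool)) :
    (∑ c ∈ C, bitProb (A c)) ^ 2 ≤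
      bitProb {f | ∃ c ∈ C, f ∈ A c} * ∑ c ∈ C, ∑ c' ∈ C, bitProb (A c ∩ A c') := by
  classical
  have hind : ∀ B : Set (E → Bool),
      bitProb B = (∑ f : E → Bool, if f ∈ B then (1 : ℝ) else 0) / 2 ^ Fintype.card E := by
    intro B
    rw [bitProb, Finset.sum_boole, Set.ncard_eq_toFinset_card']
    congr 3
    ext; simp
  set K : ℝ := 2 ^ Fintype.card E
  have hK : 0 < K := by positivity
  set N : (E → Bool) → ℝ := fun f => ∑ c ∈ C, if f ∈ A c then (1 : ℝ) else 0
  set I : (E → Bool) → ℝ := fun f => if ∃ c ∈ C, f ∈ A c then (1 : ℝ) else 0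
  have h1 : ∑ c ∈ C, bitProb (A c) = (∑ f, I f * N f) / K := by
    simp only [hind]
    rw [← Finset.sum_div, Finset.sum_comm]
    congr 1
    refine Finset.sum_congr rfl fun f _ => ?_
    by_cases hf : ∃ c ∈ C, f ∈ A c
    · simp only [I, N, if_pos hf, one_mul]
    · simp only [I, N, if_neg hf, zero_mul]
      push Not at hf
      exact Finset.sum_eq_zero fun c hc => if_neg (hf c hc)
  have h2 : bitProb {f | ∃ c ∈ C, f ∈ A c} = (∑ f, I f ^ 2) / K := by
    rw [hind]
    congr 1
    refine Finset.sum_congr rfl fun f _ => ?_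
    simp [I]
  have h3 : ∑ c ∈ C, ∑ c' ∈ C, bitProb (A c ∩ A c') = (∑ f, N f ^ 2) / K := by
    simp only [hind, ← Finset.sum_div]
    congr 1
    simp only [N, sq, Finset.sum_mul_sum]
    symm
    rw [Finset.sum_comm]
    refine Finset.sum_congr rfl fun c _ => ?_
    rw [Finset.sum_comm]
    refine Finset.sum_congr rfl fun c' _ => Finset.sum_congr rfl fun f _ => ?_
    by_cases h : f ∈ A c <;> by_cases h' : f ∈ A c' <;> simp [h, h']
  rw [h1, h2, h3, div_pow, div_mul_div_comm, ← sq]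
  gcongr
  exact Finset.sum_mul_sq_le_sq_mul_sq _ _ _

end Bits

section Configurations

variable {V : Type*} [DecidableEq V]

/-- The unordered pairs of distinct elements of `S`. -/
def edgesWithin (S : Finset V) : Finset (Sym2 V) := S.offDiag.image Sym2.mk.uncurry

/-- The unordered pairs joining `v` to an element of `U`. -/
def starEdges (v : V) (U : Finset V) : Finset (Sym2 V) := U.image fun u => s(v, u)

lemma mem_edgesWithin {S : Finset V} {u v : V} :
    s(u, v) ∈ edgesWithin S ↔ u ∈ S ∧ v ∈ S ∧ u ≠ v := by
  simp only [edgesWithin, Finset.mem_image, Finset.mem_offDiag, Prod.exists]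
  constructor
  · rintro ⟨a, b, ⟨ha, hb, hab⟩, h⟩
    rcases Sym2.eq_iff.1 h with ⟨rfl, rfl⟩ | ⟨rfl, rfl⟩
    · exact ⟨ha, hb, hab⟩
    · exact ⟨hb, ha, hab.symm⟩
  · intro h
    exact ⟨u, v, h, rfl⟩

lemma edgesWithin_inter (S T : Finset V) :
    edgesWithin S ∩ edgesWithin T = edgesWithin (S ∩ T) := by
  ext e
  induction e with | _ u v => simp only [Finset.mem_inter, mem_edgesWithin]; tauto

lemma card_edgesWithin (S : Finset V) : (edgesWithin S).card = S.card.choose 2 :=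
  Sym2.card_image_offDiag S

lemma card_edgesWithin_union (S T : Finset V) :
    (edgesWithin S ∪ edgesWithin T).card + (S ∩ T).card.choose 2
      = S.card.choose 2 + T.card.choose 2 := by
  rw [← card_edgesWithin, ← edgesWithin_inter, Finset.card_union_add_card_inter,
    card_edgesWithin, card_edgesWithin]

lemma card_starEdges (v : V) (U : Finset V) : (starEdges v U).card = U.card :=
  Finset.card_image_of_injective _ fun _ _ h => Sym2.congr_right.1 h

lemma disjoint_edgesWithin_starEdges {S U : Finset V} {v : V} (hv : v ∉ S) :
    Disjoint (edgesWithin S) (starEdges v U) := by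
  rw [Finset.disjoint_right]
  intro e he
  obtain ⟨u, -, rfl⟩ := Finset.mem_image.1 he
  exact fun h => hv (mem_edgesWithin.1 h).1

lemma disjoint_starEdges {U : Finset V} {v w : V} (hv : v ∉ U) (hvw : v ≠ w) :
    Disjoint (starEdges v U) (starEdges w U) := by
  rw [Finset.disjoint_left]
  intro e he he'
  obtain ⟨u, hu, rfl⟩ := Finset.mem_image.1 he
  obtain ⟨u', hu', h⟩ := Finset.mem_image.1 he'
  rcases Sym2.eq_iff.1 h with ⟨rfl, -⟩ | ⟨-, rfl⟩
  · exact hvw rfl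
  · exact hv hu'

/-- The graph whose edges are the pairs of distinct vertices carrying the bit `true`. -/
def bitGraph (f : Sym2 V → Bool) : SimpleGraph V := SimpleGraph.fromEdgeSet {e | f e = true}

/-- The vertices of a candidate configuration `(X₁, X₂, x)`. -/
def support (c : Finset V × Finset V × V) : Finset V := insert c.2.2 (c.1 ∪ c.2.1)

/-- The triples `(X₁, X₂, x)` with `X₁`, `X₂` disjoint of size `k` and `x` outside both. -/
def candidates (V : Type*) [DecidableEq V] [Fintype V] (k : ℕ) :
    Finset (Finset V × Finset V × V) :=
  (Finset.powersetCard k Finset.univ ×ˢ Finset.powersetCard k Finset.univ ×ˢ Finset.univ).filter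
    fun c => Disjoint c.1 c.2.1 ∧ c.2.2 ∉ c.1 ∧ c.2.2 ∉ c.2.1

/-- The adjacencies that `(X₁, X₂, x)` prescribes on its support: everything except the pairs
between `X₁` and `X₂`. -/
def pattern (c : Finset V × Finset V × V) (e : Sym2 V) : Bool :=
  decide (¬ ∃ u ∈ c.1, ∃ v ∈ c.2.1, e = s(u, v))

/-- No element of `X` is joined to `v`. -/
def isolatedEvent (v : V) (X : Finset V) : Set (Sym2 V → Bool) :=
  cylinder (starEdges v X) fun _ => false

/-- The vertex `v` is joined to both `X₁` and `X₂`. -/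
def dominatedEvent (c : Finset V × Finset V × V) (v : V) : Set (Sym2 V → Bool) :=
  (isolatedEvent v c.1 ∪ isolatedEvent v c.2.1)ᶜ

/-- The assignments for which `c` is a configuration. -/
def configEvent (c : Finset V × Finset V × V) : Set (Sym2 V → Bool) :=
  cylinder (edgesWithin (support c)) (pattern c) ∩ {f | ∀ v ∉ support c, f ∈ dominatedEvent c v}

lemma pattern_eq_false_iff {c : Finset V × Finset V × V} {u v : V} :
    pattern c s(u, v) = false ↔ (u ∈ c.1 ∧ v ∈ c.2.1) ∨ (v ∈ c.1 ∧ u ∈ c.2.1) := by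
  simp only [pattern, decide_eq_false_iff_not, not_not, Sym2.eq_iff]
  constructor
  · rintro ⟨a, ha, b, hb, ⟨rfl, rfl⟩ | ⟨rfl, rfl⟩⟩ <;> tauto
  · rintro (⟨h, h'⟩ | ⟨h, h'⟩)
    · exact ⟨u, h, v, h', Or.inl ⟨rfl, rfl⟩⟩
    · exact ⟨v, h, u, h', Or.inr ⟨rfl, rfl⟩⟩

lemma mem_dominatedEvent {c : Finset V × Finset V × V} {v : V} {f : Sym2 V → Bool} :
    f ∈ dominatedEvent c v ↔
      (∃ u ∈ c.1, f s(v, u) = true) ∧ ∃ u ∈ c.2.1, f s(v, u) = true := by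
  simp [dominatedEvent, isolatedEvent, cylinder, starEdges]

lemma inl_subset_support (c : Finset V × Finset V × V) : c.1 ⊆ support c := fun u hu => by
  simp [support, hu]

lemma inr_subset_support (c : Finset V × Finset V × V) : c.2.1 ⊆ support c := fun u hu => by
  simp [support, hu]

lemma apex_mem_support (c : Finset V × Finset V × V) : c.2.2 ∈ support c := by simp [support]

lemma determinedOn_dominatedEvent {c : Finset V × Finset V × V} {U : Finset V}
    (hU : support c ⊆ U) (v : V) : DeterminedOn (dominatedEvent c v) (starEdges v U) := by
  intro f g hfg hf
  have key : ∀ u ∈ support c, f s(v, u) = g s(v, u) := fun u hu =>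
    hfg _ (Finset.mem_image_of_mem _ (hU hu))
  rw [mem_dominatedEvent] at hf ⊢
  obtain ⟨⟨a, ha, ha'⟩, b, hb, hb'⟩ := hf
  exact ⟨⟨a, ha, by rw [← key a (inl_subset_support c ha), ha']⟩,
    b, hb, by rw [← key b (inr_subset_support c hb), hb']⟩

lemma isolatedEvent_inter (v : V) (X Y : Finset V) :
    isolatedEvent v X ∩ isolatedEvent v Y = isolatedEvent v (X ∪ Y) := by
  ext f
  simp only [isolatedEvent, cylinder, starEdges, Finset.image_union, Finset.mem_union,
    Set.mem_inter_iff, Set.mem_ofPred_eq]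
  grind

lemma card_overlap_add_le {k : ℕ} {X₁ X₂ Y₁ Y₂ W : Finset V} {x y u₀ v₀ : V}
    (hX₁ : X₁.card = k) (hX₂ : X₂.card = k) (hX : Disjoint X₁ X₂) (hY : Disjoint Y₁ Y₂)
    (hx₁ : x ∉ X₁) (hx₂ : x ∉ X₂)
    (hW : W ⊆ insert x (X₁ ∪ X₂) ∩ insert y (Y₁ ∪ Y₂))
    (hR : ∀ u ∈ W, ∀ v ∈ W, u ≠ v → ((u ∈ X₁ ∧ v ∈ X₂) ∨ (v ∈ X₁ ∧ u ∈ X₂) ↔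
      (u ∈ Y₁ ∧ v ∈ Y₂) ∨ (v ∈ Y₁ ∧ u ∈ Y₂)))
    (hu : u₀ ∈ W) (hv : v₀ ∈ W) (huX : u₀ ∈ X₁) (hvX : v₀ ∈ X₂) (huY : u₀ ∈ Y₁) (hvY : v₀ ∈ Y₂) :
    W.card + ((X₁ \ Y₁).card + (X₂ \ Y₂).card + if x = y then 0 else 1) ≤ 2 * k + 1 := by
  have hXd : ∀ w, w ∈ X₁ → w ∈ X₂ → False := fun w h h' => Finset.disjoint_left.1 hX h h'
  have hYd : ∀ w, w ∈ Y₁ → w ∈ Y₂ → False := fun w h h' => Finset.disjoint_left.1 hY h h'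
  have hsub : W ⊆ (X₁ ∩ Y₁) ∪ (X₂ ∩ Y₂) ∪ (if x = y then {x} else ∅) := by
    intro w hw
    have hwU := hW hw
    simp only [Finset.mem_inter, Finset.mem_insert, Finset.mem_union] at hwU
    have h1 := hR w hw v₀ hv
    have h2 := hR u₀ hu w hw
    rcases hwU with ⟨rfl | hw1 | hw2, hwT⟩
    · have hxv : w ≠ v₀ := fun h => hx₂ (h ▸ hvX)
      have hxu : u₀ ≠ w := fun h => hx₁ (h ▸ huX)
      have hwy : w = y := by grind
      simp [hwy]
    · have hwv : w ≠ v₀ := fun h => hXd _ hw1 (h ▸ hvX)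
      have : w ∈ Y₁ := by grind
      simp [hw1, this]
    · have hwu : u₀ ≠ w := fun h => hXd _ huX (h ▸ hw2)
      have : w ∈ Y₂ := by grind
      simp [hw2, this]
  have hcard := (Finset.card_le_card hsub).trans
    ((Finset.card_union_le _ _).trans (Nat.add_le_add_right (Finset.card_union_le _ _) _))
  have e1 := Finset.card_sdiff_add_card_inter X₁ Y₁
  have e2 := Finset.card_sdiff_add_card_inter X₂ Y₂
  split_ifs at hcard ⊢ <;> simp only [Finset.card_singleton, Finset.card_empty] at hcard <;> omega

variable [Fintype V]

lemma mem_candidates {k : ℕ} {c : Finset V × Finset V × V} :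
    c ∈ candidates V k ↔ (c.1.card = k ∧ c.2.1.card = k) ∧
      Disjoint c.1 c.2.1 ∧ c.2.2 ∉ c.1 ∧ c.2.2 ∉ c.2.1 := by
  simp [candidates]

lemma card_support {k : ℕ} {c : Finset V × Finset V × V} (hc : c ∈ candidates V k) :
    (support c).card = 2 * k + 1 := by
  obtain ⟨⟨h1, h2⟩, hd, hx, hx'⟩ := mem_candidates.1 hc
  rw [support, Finset.card_insert_of_notMem (by simp [hx, hx']), Finset.card_union_of_disjoint hd,
    h1, h2]
  ring

lemma bitProb_isolatedEvent (v : V) (X : Finset V) :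
    bitProb (isolatedEvent v X) = (1 / 2 : ℝ) ^ X.card := by
  rw [isolatedEvent, bitProb_cylinder, card_starEdges]

lemma bitProb_dominatedEvent {k : ℕ} {c : Finset V × Finset V × V} (hc : c ∈ candidates V k)
    (v : V) : bitProb (dominatedEvent c v) = (1 - (1 / 2 : ℝ) ^ k) ^ 2 := by
  obtain ⟨⟨h1, h2⟩, hd, -, -⟩ := mem_candidates.1 hc
  have h := bitProb_union_add_inter (isolatedEvent v c.1) (isolatedEvent v c.2.1)
  rw [isolatedEvent_inter, bitProb_isolatedEvent, bitProb_isolatedEvent, bitProb_isolatedEvent,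
    Finset.card_union_of_disjoint hd, h1, h2, pow_add] at h
  rw [dominatedEvent, bitProb_compl]
  linarith

lemma bitProb_configEvent {k : ℕ} {c : Finset V × Finset V × V} (hc : c ∈ candidates V k) :
    bitProb (configEvent c) = (1 / 2 : ℝ) ^ (2 * k + 1).choose 2 *
      ((1 - (1 / 2 : ℝ) ^ k) ^ 2) ^ (Fintype.card V - (2 * k + 1)) := by
  have hset : configEvent c = cylinder (edgesWithin (support c)) (pattern c) ∩
      {f | ∀ v ∈ (support c)ᶜ, f ∈ dominatedEvent c v} := by
    simp [configEvent]
  rw [hset, bitProb_inter_biInter _ (determinedOn_cylinder _ _)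
      (fun v _ => determinedOn_dominatedEvent subset_rfl v)
      (fun v hv => disjoint_edgesWithin_starEdges (Finset.mem_compl.1 hv))
      (fun v hv w _ hvw => disjoint_starEdges (Finset.mem_compl.1 hv) hvw),
    bitProb_cylinder, card_edgesWithin, card_support hc]
  simp only [bitProb_dominatedEvent hc, Finset.prod_const]
  rw [Finset.card_compl, card_support hc]

/-- Inclusion–exclusion bound for the probability that a vertex is dominated twice. -/
lemma bitProb_dominatedEvent_inter_le {k : ℕ} {c c' : Finset V × Finset V × V}
    (hc : c ∈ candidates V k) (hc' : c' ∈ candidates V k) (v : V) :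
    bitProb (dominatedEvent c v ∩ dominatedEvent c' v) ≤
      ((1 - (1 / 2 : ℝ) ^ k) ^ 2) ^ 2 +
        4 * ((1 / 2 : ℝ) ^ k) ^ 2 * 2 ^ (support c ∩ support c').card := by
  set m := (support c ∩ support c').card
  set q := (1 / 2 : ℝ) ^ k
  have pair : ∀ X Y : Finset V, X.card = k → Y.card = k → X ⊆ support c → Y ⊆ support c' →
      bitProb (isolatedEvent v X ∩ isolatedEvent v Y) ≤ q ^ 2 * 2 ^ m := by
    intro X Y hX hY hXc hYc
    have hm : (X ∩ Y).card ≤ m := Finset.card_le_card (Finset.inter_subset_inter hXc hYc)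
    have hu := Finset.card_union_add_card_inter X Y
    rw [isolatedEvent_inter, bitProb_isolatedEvent]
    have h2 : q ^ 2 * 2 ^ m = (1 / 2 : ℝ) ^ (X ∪ Y).card * 2 ^ (m - (X ∩ Y).card) := by
      have h3 : q ^ 2 = (1 / 2 : ℝ) ^ (X ∪ Y).card * (1 / 2 : ℝ) ^ (X ∩ Y).card := by
        rw [← pow_add, hu, hX, hY, pow_add, sq]
      rw [h3, ← Nat.sub_add_cancel hm, pow_add, Nat.sub_add_cancel hm]
      have : (1 / 2 : ℝ) ^ (X ∩ Y).card * 2 ^ (X ∩ Y).card = 1 := by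
        rw [← mul_pow]; norm_num
      linear_combination (1 / 2 : ℝ) ^ (X ∪ Y).card * 2 ^ (m - (X ∩ Y).card) * this
    rw [h2]
    exact le_mul_of_one_le_right (by positivity) (one_le_pow₀ (by norm_num))
  obtain ⟨⟨h1, h2⟩, -⟩ := mem_candidates.1 hc
  obtain ⟨⟨h1', h2'⟩, -⟩ := mem_candidates.1 hc'
  have hB := bitProb_dominatedEvent hc v
  have hB' := bitProb_dominatedEvent hc' v
  have hsum := bitProb_union_add_inter (dominatedEvent c v)ᶜ (dominatedEvent c' v)ᶜ
  rw [← Set.compl_inter, bitProb_compl, bitProb_compl, bitProb_compl, hB, hB'] at hsum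
  have hcc : bitProb ((dominatedEvent c v)ᶜ ∩ (dominatedEvent c' v)ᶜ) ≤ 4 * (q ^ 2 * 2 ^ m) := by
    simp only [dominatedEvent, compl_compl, Set.union_inter_distrib_right,
      Set.inter_union_distrib_left]
    have e1 := pair _ _ h1 h1' (inl_subset_support c) (inl_subset_support c')
    have e2 := pair _ _ h1 h2' (inl_subset_support c) (inr_subset_support c')
    have e3 := pair _ _ h2 h1' (inr_subset_support c) (inl_subset_support c')
    have e4 := pair _ _ h2 h2' (inr_subset_support c) (inr_subset_support c')
    refine (bitProb_union_le _ _).trans ?_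
    refine (add_le_add (bitProb_union_le _ _) (bitProb_union_le _ _)).trans ?_
    linarith
  nlinarith [sq_nonneg (1 - (1 - q) ^ 2)]

/-- Joint probability of two candidates, in terms of any bound for the dominating events. -/
lemma bitProb_configEvent_inter_le {k : ℕ} {c c' : Finset V × Finset V × V}
    (hc : c ∈ candidates V k) (hc' : c' ∈ candidates V k) {ρ : ℝ}
    (hρ : ∀ v, bitProb (dominatedEvent c v ∩ dominatedEvent c' v) ≤ ρ) :
    bitProb (configEvent c ∩ configEvent c') ≤
      ((1 / 2 : ℝ) ^ (2 * k + 1).choose 2) ^ 2 * 2 ^ (support c ∩ support c').card.choose 2 *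
        ρ ^ (support c ∪ support c')ᶜ.card := by
  by_cases hne : (configEvent c ∩ configEvent c').Nonempty
  · obtain ⟨f₀, hf₀⟩ := hne
    set U := support c ∪ support c'
    set F := edgesWithin (support c) ∪ edgesWithin (support c')
    have hsub : configEvent c ∩ configEvent c' ⊆ cylinder F f₀ ∩
        {f | ∀ v ∈ Uᶜ, f ∈ dominatedEvent c v ∩ dominatedEvent c' v} := by
      intro f hf
      refine ⟨fun e he => ?_, fun v hv => ?_⟩
      · rcases Finset.mem_union.1 he with he | he
        · rw [hf.1.1 e he, hf₀.1.1 e he]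
        · rw [hf.2.1 e he, hf₀.2.1 e he]
      · simp only [U, Finset.mem_compl, Finset.mem_union, not_or] at hv
        exact ⟨hf.1.2 v hv.1, hf.2.2 v hv.2⟩
    have hFU : F ⊆ edgesWithin U := by
      intro e
      induction e with | _ u v => simp only [F, U, Finset.mem_union, mem_edgesWithin]; tauto
    have hcard := card_edgesWithin_union (support c) (support c')
    rw [card_support hc, card_support hc'] at hcard
    refine (bitProb_mono hsub).trans ?_
    have hdet : ∀ v, DeterminedOn (dominatedEvent c v ∩ dominatedEvent c' v) (starEdges v U) :=
      fun v f g hfg hf =>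
        ⟨determinedOn_dominatedEvent Finset.subset_union_left v f g hfg hf.1,
          determinedOn_dominatedEvent Finset.subset_union_right v f g hfg hf.2⟩
    rw [bitProb_inter_biInter _ (determinedOn_cylinder _ _) (fun v _ => hdet v)
        (fun v hv => (disjoint_edgesWithin_starEdges (Finset.mem_compl.1 hv)).mono_left hFU)
        (fun v hv w _ hvw => disjoint_starEdges (Finset.mem_compl.1 hv) hvw),
      bitProb_cylinder, ← pow_mul, mul_comm _ 2, two_mul, ← hcard, pow_add]
    have h2 : (1 / 2 : ℝ) ^ (support c ∩ support c').card.choose 2 *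
        2 ^ (support c ∩ support c').card.choose 2 = 1 := by
      rw [← mul_pow]; norm_num
    rw [mul_assoc ((1 / 2 : ℝ) ^ F.card), h2, mul_one]
    gcongr
    rw [← Finset.prod_const]
    exact Finset.prod_le_prod (fun v _ => bitProb_nonneg _) fun v _ => hρ v
  · rw [Set.not_nonempty_iff_eq_empty] at hne
    rw [hne]
    by_cases hU : (support c ∪ support c')ᶜ.Nonempty
    · obtain ⟨v, -⟩ := hU
      have : 0 ≤ ρ := (bitProb_nonneg _).trans (hρ v)
      simp only [bitProb, Set.ncard_empty, Nat.cast_zero, zero_div]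
      positivity
    · rw [Finset.not_nonempty_iff_eq_empty] at hU
      simp only [bitProb, Set.ncard_empty, Nat.cast_zero, zero_div, hU, Finset.card_empty, pow_zero]
      positivity

/-- Two compatible candidates with a large overlap agree, up to exchanging the two cliques,
on that overlap. -/
lemma card_overlap_add_le_of_nonempty {k : ℕ} {c c' : Finset V × Finset V × V}
    (hc : c ∈ candidates V k) (hc' : c' ∈ candidates V k)
    (hne : (configEvent c ∩ configEvent c').Nonempty)
    (hm : k + 1 < (support c ∩ support c').card) :
    (support c ∩ support c').card + ((c.1 \ c'.1).card + (c.2.1 \ c'.2.1).card +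
        if c.2.2 = c'.2.2 then 0 else 1) ≤ 2 * k + 1 ∨
      (support c ∩ support c').card + ((c.1 \ c'.2.1).card + (c.2.1 \ c'.1).card +
        if c.2.2 = c'.2.2 then 0 else 1) ≤ 2 * k + 1 := by
  obtain ⟨⟨h1, h2⟩, hd, hx, hx'⟩ := mem_candidates.1 hc
  obtain ⟨-, hd', -, -⟩ := mem_candidates.1 hc'
  obtain ⟨f₀, hf, hf'⟩ := hne
  have hR : ∀ u ∈ support c ∩ support c', ∀ v ∈ support c ∩ support c', u ≠ v →
      ((u ∈ c.1 ∧ v ∈ c.2.1) ∨ (v ∈ c.1 ∧ u ∈ c.2.1) ↔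
        (u ∈ c'.1 ∧ v ∈ c'.2.1) ∨ (v ∈ c'.1 ∧ u ∈ c'.2.1)) := by
    intro u hu v hv huv
    rw [Finset.mem_inter] at hu hv
    rw [← pattern_eq_false_iff, ← pattern_eq_false_iff,
      ← hf.1 _ (mem_edgesWithin.2 ⟨hu.1, hv.1, huv⟩),
      ← hf'.1 _ (mem_edgesWithin.2 ⟨hu.2, hv.2, huv⟩)]
  have meets : ∀ X Y : Finset V, support c = insert c.2.2 (X ∪ Y) → Y.card = k →
      ∃ u ∈ support c ∩ support c', u ∈ X := by
    intro X Y hS hY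
    by_contra! hcon
    have hsub : support c ∩ support c' ⊆ insert c.2.2 Y := by
      intro w hw
      have h := (Finset.mem_inter.1 hw).1
      rw [hS] at h
      have := hcon w hw
      simp only [Finset.mem_insert, Finset.mem_union] at h ⊢
      tauto
    have := (Finset.card_le_card hsub).trans (Finset.card_insert_le _ _)
    omega
  obtain ⟨u₀, hu, huX⟩ := meets c.1 c.2.1 rfl h2
  obtain ⟨v₀, hv, hvX⟩ := meets c.2.1 c.1 (by rw [support, Finset.union_comm]) h1
  have huv : u₀ ≠ v₀ := fun h => Finset.disjoint_left.1 hd huX (h ▸ hvX)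
  rcases (hR u₀ hu v₀ hv huv).1 (Or.inl ⟨huX, hvX⟩) with ⟨hu', hv'⟩ | ⟨hv', hu'⟩
  · exact Or.inl (card_overlap_add_le h1 h2 hd hd' hx hx' subset_rfl hR hu hv huX hvX hu' hv')
  · refine Or.inr (card_overlap_add_le h1 h2 hd hd'.symm hx hx' ?_ (fun u hu v hv huv => ?_)
      hu hv huX hvX hu' hv')
    · rw [Finset.union_comm c'.2.1]; exact subset_rfl
    · rw [hR u hu v hv huv]; tauto

/-- There are at least `(n - 2k) ^ (2k + 1) / k! ^ 2` candidates. -/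
lemma pow_div_factorial_le_card_candidates {k : ℕ} (hk : 2 * k ≤ Fintype.card V) :
    ((Fintype.card V : ℝ) - 2 * k) ^ (2 * k + 1) / (k.factorial : ℝ) ^ 2 ≤
      (candidates V k).card := by
  have hcard : (candidates V k).card = (Fintype.card V).choose k *
      ((Fintype.card V - k).choose k * (Fintype.card V - 2 * k)) := by
    have hmap : candidates V k = (Finset.powersetCard k (Finset.univ : Finset V)).biUnion fun X₁ =>
        (Finset.powersetCard k X₁ᶜ).biUnion fun X₂ =>
          ((X₁ ∪ X₂)ᶜ).image fun x => (X₁, X₂, x) := by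
      ext ⟨X₁, X₂, x⟩
      simp only [mem_candidates, Finset.mem_biUnion, Finset.mem_powersetCard, Finset.mem_image,
        Finset.mem_compl, Finset.mem_union, Prod.mk.injEq, Finset.subset_univ, true_and]
      constructor
      · rintro ⟨⟨h1, h2⟩, hd, hx, hx'⟩
        exact ⟨X₁, h1, X₂, ⟨Finset.subset_compl_iff_disjoint_left.2 hd, h2⟩, x, by tauto,
          rfl, rfl, rfl⟩
      · rintro ⟨_, h1, _, ⟨hd, h2⟩, _, hx, rfl, rfl, rfl⟩
        exact ⟨⟨h1, h2⟩, Finset.subset_compl_iff_disjoint_left.1 hd, by tauto⟩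
    rw [hmap, Finset.card_biUnion]
    · rw [Finset.sum_const_nat (m := (Fintype.card V - k).choose k * (Fintype.card V - 2 * k)),
        Finset.card_powersetCard, Finset.card_univ]
      intro X₁ hX₁
      have hX₁k := (Finset.mem_powersetCard.1 hX₁).2
      rw [Finset.card_biUnion]
      · rw [Finset.sum_const_nat (m := Fintype.card V - 2 * k), Finset.card_powersetCard,
          Finset.card_compl, hX₁k]
        intro X₂ hX₂
        obtain ⟨hd, hX₂k⟩ := Finset.mem_powersetCard.1 hX₂
        rw [Finset.card_image_of_injective _ (fun a b h => by simpa using h), Finset.card_compl,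
          Finset.card_union_of_disjoint (Finset.subset_compl_iff_disjoint_left.1 hd), hX₁k, hX₂k,
          two_mul]
      · intro a _ b _ hab
        simp only [Finset.disjoint_left, Finset.mem_image]
        grind
    · intro a _ b _ hab
      simp only [Finset.disjoint_left, Finset.mem_biUnion, Finset.mem_image]
      grind
  set n := Fintype.card V
  have hb : 0 ≤ (n : ℝ) - 2 * k := by
    have : ((2 * k : ℕ) : ℝ) ≤ n := by exact_mod_cast hk
    push_cast at this; linarith
  have c1 : ((n : ℝ) - 2 * k) ^ k / (k.factorial : ℝ) ≤ n.choose k := by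
    refine le_trans ?_ (Nat.pow_le_choose k n)
    gcongr
    rw [Nat.cast_sub (by omega)]; push_cast
    linarith [(Nat.cast_nonneg k : (0 : ℝ) ≤ k)]
  have c2 : ((n : ℝ) - 2 * k) ^ k / (k.factorial : ℝ) ≤ (n - k).choose k := by
    refine le_trans ?_ (Nat.pow_le_choose k (n - k))
    gcongr
    rw [Nat.cast_sub (by omega)]; push_cast
    rw [Nat.cast_sub (by omega)]
    linarith
  have c3 : ((n - 2 * k : ℕ) : ℝ) = (n : ℝ) - 2 * k := by
    rw [Nat.cast_sub hk]; push_cast; ring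
  rw [hcard]; push_cast; rw [c3]
  calc ((n : ℝ) - 2 * k) ^ (2 * k + 1) / (k.factorial : ℝ) ^ 2
      = ((n : ℝ) - 2 * k) ^ k / (k.factorial : ℝ) *
        (((n : ℝ) - 2 * k) ^ k / (k.factorial : ℝ) * ((n : ℝ) - 2 * k)) := by
        field_simp; ring
    _ ≤ _ := by gcongr

/-- Bound on a sum over candidates of a product of three weights. -/
lemma sum_candidates_le {k : ℕ} {φ ψ : Finset V → ℝ} {χ : V → ℝ} (hφ : ∀ X, 0 ≤ φ X)
    (hψ : ∀ X, 0 ≤ ψ X) (hχ : ∀ x, 0 ≤ χ x) :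
    ∑ c ∈ candidates V k, φ c.1 * ψ c.2.1 * χ c.2.2 ≤
      (∑ X ∈ Finset.powersetCard k Finset.univ, φ X) *
        (∑ X ∈ Finset.powersetCard k Finset.univ, ψ X) * ∑ x, χ x := by
  refine (Finset.sum_le_sum_of_subset_of_nonneg (Finset.filter_subset _ _)
    fun c _ _ => mul_nonneg (mul_nonneg (hφ _) (hψ _)) (hχ _)).trans (le_of_eq ?_)
  simp_rw [Finset.sum_product, ← Finset.mul_sum, mul_assoc, ← Finset.mul_sum, ← Finset.sum_mul]

end Configurations

/-- The elementary symmetric sums are bounded by powers of the first one. -/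
lemma factorial_mul_sum_powersetCard_prod_le {V : Type*} [DecidableEq V] (k : ℕ) (S : Finset V)
    {w : V → ℝ} (hw : ∀ v, 0 ≤ w v) :
    (k.factorial : ℝ) * ∑ X ∈ Finset.powersetCard k S, ∏ v ∈ X, w v ≤ (∑ v ∈ S, w v) ^ k := by
  induction k with
  | zero => simp
  | succ k ih =>
    have hstep : ((k + 1 : ℕ) : ℝ) * ∑ X ∈ Finset.powersetCard (k + 1) S, ∏ v ∈ X, w v ≤
        (∑ v ∈ S, w v) * ∑ X ∈ Finset.powersetCard k S, ∏ v ∈ X, w v := by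
      have h1 : ((k + 1 : ℕ) : ℝ) * ∑ X ∈ Finset.powersetCard (k + 1) S, ∏ v ∈ X, w v =
          ∑ p ∈ (Finset.powersetCard (k + 1) S).sigma fun X => X, ∏ v ∈ p.1, w v := by
        rw [Finset.sum_sigma, Finset.mul_sum]
        refine Finset.sum_congr rfl fun X hX => ?_
        simp [(Finset.mem_powersetCard.1 hX).2]
      rw [h1, Finset.sum_mul_sum, ← Finset.sum_product']
      have hinj : Set.InjOn (fun p : (Σ _ : Finset V, V) => (p.2, p.1.erase p.2))
          ((Finset.powersetCard (k + 1) S).sigma fun X => X) := by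
        rintro ⟨X, v⟩ hX ⟨Y, u⟩ hY h
        simp only [Finset.coe_sigma, Set.mem_sigma_iff, Finset.mem_coe, Prod.mk.injEq] at hX hY h
        obtain ⟨rfl, h⟩ := h
        rw [← Finset.insert_erase hX.2, h, Finset.insert_erase hY.2]
      calc _ = ∑ p ∈ (Finset.powersetCard (k + 1) S).sigma fun X => X,
            w p.2 * ∏ v ∈ p.1.erase p.2, w v := by
            refine Finset.sum_congr rfl fun p hp => ?_
            rw [Finset.mul_prod_erase _ _ (Finset.mem_sigma.1 hp).2]
        _ = ∑ y ∈ ((Finset.powersetCard (k + 1) S).sigma fun X => X).image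
              (fun p => (p.2, p.1.erase p.2)), w y.1 * ∏ v ∈ y.2, w v := by
            rw [Finset.sum_image hinj]
        _ ≤ _ := by
            refine Finset.sum_le_sum_of_subset_of_nonneg ?_ fun y _ _ =>
              mul_nonneg (hw _) (Finset.prod_nonneg fun v _ => hw v)
            rintro y hy
            obtain ⟨⟨X, v⟩, hX, rfl⟩ := Finset.mem_image.1 hy
            obtain ⟨hX, hv⟩ := Finset.mem_sigma.1 hX
            obtain ⟨hXS, hXk⟩ := Finset.mem_powersetCard.1 hX
            refine Finset.mem_product.2 ⟨hXS hv, Finset.mem_powersetCard.2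
              ⟨(Finset.erase_subset _ _).trans hXS, ?_⟩⟩
            rw [Finset.card_erase_of_mem hv, hXk, Nat.add_sub_cancel]
    rw [Nat.factorial_succ, pow_succ']
    push_cast at hstep ⊢
    have h0 : 0 ≤ ∑ v ∈ S, w v := Finset.sum_nonneg fun v _ => hw v
    calc _ = (k.factorial : ℝ) * (((k : ℝ) + 1) *
          ∑ X ∈ Finset.powersetCard (k + 1) S, ∏ v ∈ X, w v) := by ring
      _ ≤ (k.factorial : ℝ) * ((∑ v ∈ S, w v) *
          ∑ X ∈ Finset.powersetCard k S, ∏ v ∈ X, w v) := by gcongr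
      _ = (∑ v ∈ S, w v) * ((k.factorial : ℝ) *
          ∑ X ∈ Finset.powersetCard k S, ∏ v ∈ X, w v) := by ring
      _ ≤ _ := by gcongr

section Weights

variable {V : Type*} [DecidableEq V] [Fintype V]

lemma sum_ite_mem_le (S : Finset V) (γ : ℝ) :
    ∑ v, (if v ∈ S then γ else 1) ≤ Fintype.card V + S.card * γ := by
  rw [Finset.sum_ite, Finset.sum_const, Finset.sum_const, nsmul_eq_mul, nsmul_eq_mul, mul_one,
    Finset.filter_univ_mem, add_comm]
  gcongr
  exact Finset.card_le_univ _

lemma sum_pow_card_inter_le (k : ℕ) (S : Finset V) {γ : ℝ} (hγ : 0 ≤ γ) :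
    ∑ X ∈ Finset.powersetCard k Finset.univ, γ ^ (X ∩ S).card ≤
      (Fintype.card V + S.card * γ) ^ k / (k.factorial : ℝ) := by
  have hsum := sum_ite_mem_le S γ
  have h := factorial_mul_sum_powersetCard_prod_le k (Finset.univ : Finset V)
    (w := fun v => if v ∈ S then γ else 1) (fun v => by split_ifs <;> positivity)
  have hprod : ∀ X : Finset V, ∏ v ∈ X, (if v ∈ S then γ else 1) = γ ^ (X ∩ S).card := by
    intro X
    rw [Finset.prod_ite, Finset.prod_const, Finset.prod_const_one, mul_one,
      Finset.filter_mem_eq_inter]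
  simp only [hprod] at h
  rw [le_div_iff₀' (by positivity)]
  refine h.trans (pow_le_pow_left₀ (Finset.sum_nonneg fun v _ => ?_) hsum k)
  split_ifs <;> positivity

lemma sum_pow_card_sdiff_le {k : ℕ} {X : Finset V} (hX : X.card = k) {α β : ℝ} (hα : 0 ≤ α)
    (hβ : 0 ≤ β) :
    ∑ Y ∈ Finset.powersetCard k Finset.univ, (α * β) ^ (X \ Y).card ≤
      (1 + α) ^ k * (1 + β) ^ Fintype.card V := by
  have hbin : ∀ (s : Finset V) (a : ℝ), ∑ A ∈ s.powerset, a ^ A.card = (1 + a) ^ s.card := by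
    intro s a
    rw [add_comm, ← Finset.sum_pow_mul_eq_add_pow]
    simp
  have hinj : Function.Injective fun Y : Finset V => (X \ Y, Y \ X) := by
    intro Y Z h
    simp only [Prod.mk.injEq] at h
    ext v
    have h1 := Finset.ext_iff.1 h.1 v
    have h2 := Finset.ext_iff.1 h.2 v
    simp only [Finset.mem_sdiff] at h1 h2
    tauto
  calc _ = ∑ Y ∈ Finset.powersetCard k (Finset.univ : Finset V),
        α ^ (X \ Y).card * β ^ (Y \ X).card := by
        refine Finset.sum_congr rfl fun Y hY => ?_
        rw [mul_pow, Finset.card_sdiff_comm (hX.trans (Finset.mem_powersetCard.1 hY).2.symm)]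
    _ = ∑ p ∈ (Finset.powersetCard k (Finset.univ : Finset V)).image fun Y => (X \ Y, Y \ X),
        α ^ p.1.card * β ^ p.2.card := by
        rw [Finset.sum_image hinj.injOn]
    _ ≤ ∑ p ∈ X.powerset ×ˢ (Finset.univ : Finset V).powerset, α ^ p.1.card * β ^ p.2.card := by
        refine Finset.sum_le_sum_of_subset_of_nonneg ?_ fun p _ _ => by positivity
        intro p hp
        obtain ⟨Y, -, rfl⟩ := Finset.mem_image.1 hp
        simp
    _ = _ := by
        simp only [Finset.sum_product]
        rw [← Finset.sum_mul_sum, hbin, hbin, hX, Finset.card_univ]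

lemma sum_ite_eq_le (x : V) {δ : ℝ} (hδ : 0 ≤ δ) :
    ∑ y, (if x = y then 1 else δ) ≤ 1 + Fintype.card V * δ := by
  calc _ ≤ ∑ y, ((if x = y then 1 else 0) + δ) :=
        Finset.sum_le_sum fun y _ => by split_ifs <;> linarith
    _ = _ := by simp [Finset.sum_add_distrib]

lemma card_inter_support {k : ℕ} {c : Finset V × Finset V × V} (hc : c ∈ candidates V k)
    (S : Finset V) : (S ∩ support c).card =
      (c.1 ∩ S).card + (c.2.1 ∩ S).card + if c.2.2 ∈ S then 1 else 0 := by
  obtain ⟨-, hd, hx, hx'⟩ := mem_candidates.1 hc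
  rw [Finset.inter_comm, support]
  have hu : ((c.1 ∪ c.2.1) ∩ S).card = (c.1 ∩ S).card + (c.2.1 ∩ S).card := by
    rw [Finset.union_inter_distrib_right, Finset.card_union_of_disjoint]
    exact hd.mono Finset.inter_subset_left Finset.inter_subset_left
  split_ifs with h
  · rw [Finset.insert_inter_of_mem h, Finset.card_insert_of_notMem (by simp [hx, hx']), hu]
  · rw [Finset.insert_inter_of_notMem h, hu, add_zero]

end Weights

section Asymptotics

variable {V : Type*} [Fintype V] {k : ℕ} {t : ℝ}

lemma choose_two_mul_add_one (k : ℕ) : (2 * k + 1).choose 2 = k * (2 * k + 1) := by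
  rw [Nat.choose_two_right, Nat.add_sub_cancel]
  rw [show (2 * k + 1) * (2 * k) = 2 * (k * (2 * k + 1)) by ring]
  omega

lemma card_mul_pow_four (hq : t ^ 4 = (1 / 2 : ℝ) ^ k) (hn : Fintype.card V = 2 ^ k * k) :
    (Fintype.card V : ℝ) * t ^ 4 = k := by
  have h : (2 : ℝ) ^ k * (1 / 2 : ℝ) ^ k = 1 := by rw [← mul_pow]; norm_num
  rw [hq, hn]; push_cast
  linear_combination (k : ℝ) * h

lemma card_pow_mul_half_pow (hn : Fintype.card V = 2 ^ k * k) :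
    (Fintype.card V : ℝ) ^ (2 * k + 1) * (1 / 2 : ℝ) ^ (2 * k + 1).choose 2 =
      (k : ℝ) ^ (2 * k + 1) := by
  rw [hn, choose_two_mul_add_one]; push_cast
  rw [mul_pow, ← pow_mul, mul_right_comm, ← mul_pow]
  norm_num

variable [DecidableEq V]

/-- The probability that a given candidate is a configuration. -/
noncomputable def configProb (n k : ℕ) : ℝ :=
  (1 / 2 : ℝ) ^ (2 * k + 1).choose 2 * ((1 - (1 / 2 : ℝ) ^ k) ^ 2) ^ (n - (2 * k + 1))

lemma pow_mul_exp_le_factorial_sq (k : ℕ) :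
    (k : ℝ) ^ (2 * k + 1) * exp (-(2 * k)) ≤ (k.factorial : ℝ) ^ 2 := by
  have h := Stirling.le_factorial_stirling k
  have h2 := pow_le_pow_left₀ (by positivity) h 2
  rw [mul_pow, Real.sq_sqrt (by positivity), ← pow_mul, div_pow, ← exp_nat_mul, mul_one] at h2
  refine le_trans ?_ h2
  rw [exp_neg]
  have he : exp (2 * k) = exp ((k * 2 : ℕ) : ℝ) := by congr 1; push_cast; ring
  rw [he, mul_comm k 2, pow_succ]
  have hpi : (1 : ℝ) ≤ 2 * π := by linarith [Real.pi_gt_three]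
  calc _ = (k : ℝ) * ((k : ℝ) ^ (2 * k) / exp ((2 * k : ℕ) : ℝ)) := by field_simp
    _ ≤ (2 * π * k) * ((k : ℝ) ^ (2 * k) / exp ((2 * k : ℕ) : ℝ)) := by
      gcongr
      nlinarith [(Nat.cast_nonneg k : (0 : ℝ) ≤ k)]

lemma factorial_sq_le (hk : k ≠ 0) :
    (k.factorial : ℝ) ^ 2 ≤ exp 2 * ((k : ℝ) ^ (2 * k + 1) * exp (-(2 * k))) := by
  obtain ⟨j, rfl⟩ := Nat.exists_eq_succ_of_ne_zero hk
  have h := Stirling.stirlingSeq'_antitone (Nat.zero_le j)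
  simp only [Function.comp, Nat.succ_eq_add_one, zero_add, Stirling.stirlingSeq_one] at h
  rw [Stirling.stirlingSeq, div_le_iff₀ (by positivity)] at h
  have h2 := pow_le_pow_left₀ (by positivity) h 2
  set k := j + 1
  have e1 : (exp 1 / √2 * (√(2 * (k : ℝ)) * ((k : ℝ) / exp 1) ^ k)) ^ 2 =
      exp 2 * ((k : ℝ) ^ (2 * k + 1) * exp (-(2 * k))) := by
    rw [mul_pow, mul_pow, div_pow, Real.sq_sqrt (by positivity), Real.sq_sqrt (by positivity),
      ← pow_mul, div_pow, ← exp_nat_mul, ← exp_nat_mul, exp_neg]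
    have he : exp (2 * k) = exp (((k * 2 : ℕ) : ℝ) * 1) := by congr 1; push_cast; ring
    rw [he]
    push_cast
    rw [mul_one, mul_comm k 2, pow_succ]
    field_simp
  rw [← e1]
  exact h2

/-- Elementary consequences of the smallness of `t`, where `t ^ 4 = 2 ^ (-k)`. -/
lemma smallness (ht : 0 < t) (hq : t ^ 4 = (1 / 2 : ℝ) ^ k)
    (hsmall : 200 * (2 * (k : ℝ) + 1) ^ 2 * t ≤ 1) :
    k ≠ 0 ∧ t ≤ 1 / 200 ∧ (k : ℝ) * t ≤ 1 / 200 ∧ (2 * (k : ℝ) + 1) * t ≤ 1 / 200 := by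
  have hk0 : (0 : ℝ) ≤ k := Nat.cast_nonneg k
  have hkt : 0 ≤ (k : ℝ) * t := by positivity
  have hkkt : 0 ≤ (k : ℝ) * k * t := by positivity
  refine ⟨?_, by nlinarith, by nlinarith, by nlinarith⟩
  rintro rfl
  have h1 : t ^ 4 < 1 := pow_lt_one₀ ht.le (by norm_num at hsmall; linarith) (by norm_num)
  simp at hq
  linarith

lemma half_le_pow (ht : 0 < t) (hq : t ^ 4 = (1 / 2 : ℝ) ^ k)
    (hsmall : 200 * (2 * (k : ℝ) + 1) ^ 2 * t ≤ 1) :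
    (1 / 2 : ℝ) ≤ ((1 - (1 / 2 : ℝ) ^ k) ^ 2) ^ (2 * k + 1) := by
  obtain ⟨-, ht1, -, hst⟩ := smallness ht hq hsmall
  have ht4 : t ^ 4 ≤ t := by
    calc t ^ 4 ≤ t ^ 1 := pow_le_pow_of_le_one ht.le (by linarith) (by norm_num)
      _ = t := pow_one t
  rw [← hq, ← pow_mul]
  have h := one_add_mul_le_pow (a := -t ^ 4) (by linarith) (2 * (2 * k + 1))
  rw [← sub_eq_add_neg] at h
  refine le_trans ?_ h
  push_cast
  nlinarith

/-- Joint probability of two candidates in terms of the number of pairs inside their overlap. -/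
lemma bitProb_configEvent_inter_le_choose (ht : 0 < t) (hq : t ^ 4 = (1 / 2 : ℝ) ^ k)
    (hsmall : 200 * (2 * (k : ℝ) + 1) ^ 2 * t ≤ 1)
    {c c' : Finset V × Finset V × V} (hc : c ∈ candidates V k) (hc' : c' ∈ candidates V k)
    {σ : ℝ} (hσ : 0 ≤ σ) (hσ1 : ∀ v, bitProb (dominatedEvent c v ∩ dominatedEvent c' v) ≤
      (1 - (1 / 2 : ℝ) ^ k) ^ 2 * σ) :
    bitProb (configEvent c ∩ configEvent c') ≤ configProb (Fintype.card V) k * 2 *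
      ((1 / 2 : ℝ) ^ (2 * k + 1).choose 2 * 2 ^ (support c ∩ support c').card.choose 2) *
        σ ^ (support c ∪ support c')ᶜ.card := by
  have hr0 : 0 ≤ (1 - (1 / 2 : ℝ) ^ k) ^ 2 := sq_nonneg _
  have hq1 : (1 / 2 : ℝ) ^ k ≤ 1 := pow_le_one₀ (by norm_num) (by norm_num)
  have hq0 : 0 < (1 / 2 : ℝ) ^ k := by positivity
  have hr1 : (1 - (1 / 2 : ℝ) ^ k) ^ 2 ≤ 1 := by
    apply pow_le_one₀ <;> linarith
  have hhalf := half_le_pow ht hq hsmall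
  set r := (1 - (1 / 2 : ℝ) ^ k) ^ 2
  set N := (support c ∪ support c')ᶜ.card
  have hN : Fintype.card V - (2 * k + 1) ≤ N + (2 * k + 1) := by
    have h1 := Finset.card_union_le (support c) (support c')
    rw [card_support hc, card_support hc'] at h1
    have h2 : N = Fintype.card V - (support c ∪ support c').card := Finset.card_compl _
    omega
  have hrN : r ^ N ≤ 2 * r ^ (Fintype.card V - (2 * k + 1)) := by
    have h1 := pow_le_pow_of_le_one hr0 hr1 hN
    rw [pow_add] at h1
    have h2 : 0 ≤ r ^ N := by positivity
    nlinarith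
  refine (bitProb_configEvent_inter_le hc hc' hσ1).trans ?_
  rw [mul_pow, configProb]
  set Q := (1 / 2 : ℝ) ^ (2 * k + 1).choose 2
  set M := (2 : ℝ) ^ (support c ∩ support c').card.choose 2
  have hM : 0 < M := by positivity
  have hQ : 0 < Q := by positivity
  calc Q ^ 2 * M * (r ^ N * σ ^ N)
      ≤ Q ^ 2 * M * ((2 * r ^ (Fintype.card V - (2 * k + 1))) * σ ^ N) := by gcongr
    _ = _ := by ring

/-- Bound for pairs of candidates with moderate overlap. -/
lemma bitProb_configEvent_inter_le_of_card_le (ht : 0 < t) (hq : t ^ 4 = (1 / 2 : ℝ) ^ k)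
    (hsmall : 200 * (2 * (k : ℝ) + 1) ^ 2 * t ≤ 1) (hn : Fintype.card V = 2 ^ k * k)
    {c c' : Finset V × Finset V × V} (hc : c ∈ candidates V k) (hc' : c' ∈ candidates V k)
    (hm : 2 * (support c ∩ support c').card ≤ 3 * k + 2) :
    bitProb (configEvent c ∩ configEvent c') ≤ configProb (Fintype.card V) k *
      (2 * exp 1 * (1 / 2 : ℝ) ^ (2 * k + 1).choose 2 * exp (-(2 * k)) *
        (exp 4 / t ^ 3) ^ (support c ∩ support c').card) := by
  obtain ⟨hk, ht1, hkt, hst⟩ := smallness ht hq hsmall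
  set m := (support c ∩ support c').card
  have hp : 0 ≤ configProb (Fintype.card V) k := by
    unfold configProb; positivity
  have hchoose : (2 : ℝ) ^ m.choose 2 ≤ (1 / t ^ 3) ^ m := by
    rw [div_pow, one_pow, le_div_iff₀ (by positivity)]
    have h4 : (2 : ℝ) ^ (4 * m.choose 2) * t ^ (4 * (3 * m)) ≤ 1 := by
      rw [pow_mul t, hq, ← pow_mul]
      have hle : 4 * m.choose 2 ≤ k * (3 * m) := by
        have h := Nat.cast_choose_two ℝ m
        have hm' : (2 * m : ℝ) ≤ 3 * k + 2 := by exact_mod_cast hm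
        have hm0 : (0 : ℝ) ≤ m := Nat.cast_nonneg m
        have : (4 * m.choose 2 : ℝ) ≤ k * (3 * m) := by rw [h]; nlinarith
        exact_mod_cast this
      calc _ ≤ (2 : ℝ) ^ (k * (3 * m)) * (1 / 2 : ℝ) ^ (k * (3 * m)) := by
            gcongr; norm_num
        _ = 1 := by rw [← mul_pow]; norm_num
    by_contra! hcon
    rw [← pow_mul] at hcon
    have := one_lt_pow₀ hcon (n := 4) (by norm_num)
    rw [mul_pow, ← pow_mul, ← pow_mul, mul_comm _ 4, mul_comm _ 4] at this
    linarith
  have hexp : exp (4 * m) * (1 / t ^ 3) ^ m = (exp 4 / t ^ 3) ^ m := by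
    rw [mul_comm (4 : ℝ), exp_nat_mul, ← mul_pow, mul_one_div]
  suffices hdom : bitProb (configEvent c ∩ configEvent c') ≤ configProb (Fintype.card V) k * 2 *
      ((1 / 2 : ℝ) ^ (2 * k + 1).choose 2 * 2 ^ m.choose 2) *
        (exp 1 * exp (-(2 * k)) * exp (4 * m)) by
    refine hdom.trans ?_
    rw [← hexp]
    calc _ ≤ configProb (Fintype.card V) k * 2 *
      ((1 / 2 : ℝ) ^ (2 * k + 1).choose 2 * (1 / t ^ 3) ^ m) *
        (exp 1 * exp (-(2 * k)) * exp (4 * m)) := by gcongr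
      _ = _ := by ring
  by_cases hmk : k ≤ 2 * m
  · refine (bitProb_configEvent_inter_le_choose ht hq hsmall hc hc' zero_le_one
      fun v => ?_).trans ?_
    · rw [mul_one, ← bitProb_dominatedEvent hc v]
      exact bitProb_mono Set.inter_subset_left
    · rw [one_pow]
      gcongr
      rw [← exp_add, ← exp_add, one_le_exp_iff]
      have : (k : ℝ) ≤ 2 * m := by exact_mod_cast hmk
      linarith
  · set q := (1 / 2 : ℝ) ^ k
    have hq0 : 0 < q := by positivity
    have ht4 : t ^ 4 ≤ t := by
      calc t ^ 4 ≤ t ^ 1 := pow_le_pow_of_le_one ht.le (by linarith) (by norm_num)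
        _ = t := pow_one t
    have hqm : q * 2 ^ m ≤ t ^ 2 := by
      have h1 : (q * 2 ^ m) ^ 2 ≤ (t ^ 2) ^ 2 := by
        have h0 : (t ^ 2) ^ 2 = q := by rw [← hq]; ring
        rw [h0, mul_pow, ← pow_mul (2 : ℝ), sq]
        have h2 : (2 : ℝ) ^ (m * 2) ≤ 2 ^ k := by gcongr; norm_num; omega
        have h3 : q * 2 ^ k = 1 := by
          simp only [q]; rw [← mul_pow]; norm_num
        nlinarith
      exact le_of_sq_le_sq h1 (by positivity)
    set z := q ^ 2 * 2 ^ m with hz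
    have hz0 : 0 ≤ z := by positivity
    have hqz : q ^ 2 ≤ z := le_mul_of_one_le_right (by positivity) (one_le_pow₀ (by norm_num))
    have hN := Finset.card_compl (support c ∪ support c')
    have hUle := Finset.card_union_le (support c) (support c')
    rw [card_support hc, card_support hc'] at hUle
    set N := (support c ∪ support c')ᶜ.card
    have hN1 : (Fintype.card V : ℝ) ≤ N + 2 * (2 * k + 1) := by
      have : Fintype.card V ≤ N + 2 * (2 * k + 1) := by omega
      exact_mod_cast this
    have hN2 : (N : ℝ) ≤ Fintype.card V := by
      have : N ≤ Fintype.card V := by omega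
      exact_mod_cast this
    have hnq : (Fintype.card V : ℝ) * q = k := by
      rw [hn]; push_cast
      have h3 : (2 : ℝ) ^ k * q = 1 := by
        simp only [q]; rw [← mul_pow]; norm_num
      linear_combination (k : ℝ) * h3
    refine (bitProb_configEvent_inter_le_choose ht hq hsmall hc hc' (exp_pos (-(2 * q - 17 * z))).le
      fun v => ?_).trans ?_
    · refine (bitProb_dominatedEvent_inter_le hc hc' v).trans ?_
      have h1 : 1 - (2 * q - 17 * z) ≤ exp (-(2 * q - 17 * z)) := by
        have := add_one_le_exp (-(2 * q - 17 * z)); linarith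
      have h2 : (1 / 4 : ℝ) ≤ (1 - q) ^ 2 := by nlinarith
      refine le_trans ?_ (mul_le_mul_of_nonneg_left h1 (sq_nonneg _))
      nlinarith
    · rw [← exp_nat_mul]
      gcongr
      rw [← exp_add, ← exp_add, exp_le_exp]
      have hm0 : (0 : ℝ) ≤ m := Nat.cast_nonneg m
      have h1 : (N : ℝ) * z ≤ k * t ^ 2 := by
        calc (N : ℝ) * z ≤ (Fintype.card V : ℝ) * z := by gcongr
          _ = ((Fintype.card V : ℝ) * q) * (q * 2 ^ m) := by rw [hz]; ring
          _ ≤ k * t ^ 2 := by rw [hnq]; gcongr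
      have h2 : (k : ℝ) ≤ N * q + 2 * (2 * k + 1) * q := by
        rw [← hnq]; nlinarith
      have h3 : (2 * (k : ℝ) + 1) * q ≤ 1 / 200 := by
        rw [← hq]
        exact (mul_le_mul_of_nonneg_left ht4 (by positivity)).trans hst
      have h4 : (k : ℝ) * t ^ 2 ≤ 1 / 200 := by nlinarith
      nlinarith

/-- Bound for pairs of candidates with large overlap. -/
lemma bitProb_configEvent_inter_le_of_lt_card (ht : 0 < t) (hq : t ^ 4 = (1 / 2 : ℝ) ^ k)
    (hsmall : 200 * (2 * (k : ℝ) + 1) ^ 2 * t ≤ 1)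
    {c c' : Finset V × Finset V × V} (hc : c ∈ candidates V k) (hc' : c' ∈ candidates V k)
    (hm : 3 * k + 2 < 2 * (support c ∩ support c').card) {d : ℕ}
    (hd : (support c ∩ support c').card + d ≤ 2 * k + 1) :
    bitProb (configEvent c ∩ configEvent c') ≤
      configProb (Fintype.card V) k * (2 * (t ^ 7) ^ d) := by
  obtain ⟨hk, ht1, hkt, hst⟩ := smallness ht hq hsmall
  set m := (support c ∩ support c').card
  have hp : 0 ≤ configProb (Fintype.card V) k := by
    unfold configProb; positivity
  refine (bitProb_configEvent_inter_le_choose ht hq hsmall hc hc' zero_le_one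
    fun v => ?_).trans ?_
  · rw [mul_one, ← bitProb_dominatedEvent hc v]
    exact bitProb_mono Set.inter_subset_left
  · rw [one_pow, mul_one, mul_assoc]
    gcongr
    refine le_of_pow_le_pow_left₀ (n := 4) (by norm_num) (by positivity) ?_
    change ((1 / 2 : ℝ) ^ (2 * k + 1).choose 2 * 2 ^ m.choose 2) ^ 4 ≤ _
    rw [← pow_mul, ← pow_mul, show 7 * (d * 4) = 4 * (7 * d) by ring, pow_mul t, hq, ← pow_mul,
      mul_pow, ← pow_mul, ← pow_mul]
    have hle : k * (7 * d) + m.choose 2 * 4 ≤ (2 * k + 1).choose 2 * 4 := by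
      have h := Nat.cast_choose_two ℝ m
      have hm' : (3 * k + 3 : ℝ) ≤ 2 * m := by exact_mod_cast hm
      have hd' : (m + d : ℝ) ≤ 2 * k + 1 := by exact_mod_cast hd
      have hd0 : (0 : ℝ) ≤ d := Nat.cast_nonneg d
      have hk0 : (0 : ℝ) ≤ k := Nat.cast_nonneg k
      have hm0 : (0 : ℝ) ≤ m := Nat.cast_nonneg m
      have : ((k * (7 * d) + m.choose 2 * 4 : ℕ) : ℝ) ≤ ((2 * k + 1).choose 2 * 4 : ℕ) := by
        rw [choose_two_mul_add_one]
        push_cast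
        rw [h]
        nlinarith
      exact_mod_cast this
    calc _ = (1 / 2 : ℝ) ^ ((2 * k + 1).choose 2 * 4 - m.choose 2 * 4) *
          ((1 / 2 : ℝ) ^ (m.choose 2 * 4) * 2 ^ (m.choose 2 * 4)) := by
          rw [← mul_assoc, ← pow_add, Nat.sub_add_cancel (by omega)]
      _ = (1 / 2 : ℝ) ^ ((2 * k + 1).choose 2 * 4 - m.choose 2 * 4) := by
          rw [← mul_pow]; norm_num
      _ ≤ _ := pow_le_pow_of_le_one (by norm_num) (by norm_num) (by omega)

/-- Total contribution of the pairs with moderate overlap. -/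
lemma sum_pow_overlap_le (ht : 0 < t) (hq : t ^ 4 = (1 / 2 : ℝ) ^ k)
    (hsmall : 200 * (2 * (k : ℝ) + 1) ^ 2 * t ≤ 1) (hn : Fintype.card V = 2 ^ k * k)
    {c : Finset V × Finset V × V} (hc : c ∈ candidates V k) :
    ∑ c' ∈ candidates V k, 2 * exp 1 * (1 / 2 : ℝ) ^ (2 * k + 1).choose 2 * exp (-(2 * k)) *
        (exp 4 / t ^ 3) ^ (support c ∩ support c').card ≤ 2 * exp 1 * exp 1 := by
  obtain ⟨hk, -, -, -⟩ := smallness ht hq hsmall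
  have hk1 : (1 : ℝ) ≤ k := by exact_mod_cast Nat.one_le_iff_ne_zero.2 hk
  set γ := exp 4 / t ^ 3
  have hγ : 0 ≤ γ := by positivity
  set n : ℝ := (Fintype.card V : ℝ) with hn'
  have hn0 : 0 < n := by rw [hn', hn]; push_cast; positivity
  have hsum : ∑ c' ∈ candidates V k, γ ^ (support c ∩ support c').card ≤
      (n + (2 * k + 1) * γ) ^ (2 * k + 1) / (k.factorial : ℝ) ^ 2 := by
    have h1 := sum_candidates_le (V := V) (k := k) (φ := fun X => γ ^ (X ∩ support c).card)
      (ψ := fun X => γ ^ (X ∩ support c).card) (χ := fun x => if x ∈ support c then γ else 1)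
      (fun X => by positivity) (fun X => by positivity) (fun x => by split_ifs <;> positivity)
    have h2 := sum_pow_card_inter_le k (support c) hγ
    have h3 := sum_ite_mem_le (support c) γ
    rw [card_support hc] at h2 h3
    push_cast at h2 h3
    calc _ = ∑ c' ∈ candidates V k, γ ^ (c'.1 ∩ support c).card * γ ^ (c'.2.1 ∩ support c).card *
          (if c'.2.2 ∈ support c then γ else 1) := by
          refine Finset.sum_congr rfl fun c' hc' => ?_
          rw [card_inter_support hc', pow_add, pow_add]
          split_ifs <;> simp
      _ ≤ _ := h1
      _ ≤ ((n + (2 * k + 1) * γ) ^ k / k.factorial) * ((n + (2 * k + 1) * γ) ^ k / k.factorial) *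
          (n + (2 * k + 1) * γ) := by
          gcongr
      _ = _ := by field_simp; ring
  have hbase : (n + (2 * k + 1) * γ) ^ (2 * k + 1) ≤ n ^ (2 * k + 1) * exp 1 := by
    have h1 : n + (2 * k + 1) * γ ≤ n * exp ((2 * k + 1) * γ / n) := by
      have := add_one_le_exp ((2 * k + 1) * γ / n)
      calc n + (2 * k + 1) * γ = n * ((2 * k + 1) * γ / n + 1) := by field_simp; ring
        _ ≤ _ := by gcongr
    have h2 : ((2 * k + 1 : ℕ) : ℝ) * ((2 * k + 1) * γ / n) ≤ 1 := by
      have hγn : γ / n = exp 4 * t / k := by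
        rw [← card_mul_pow_four (V := V) hq hn, ← hn']
        simp only [γ]
        field_simp
      have he : exp 4 ≤ 200 := by
        have h4 : exp 4 = exp 1 ^ 4 := by rw [← exp_nat_mul]; norm_num
        rw [h4]
        calc exp 1 ^ 4 ≤ 2.7182818286 ^ 4 := by gcongr; exact exp_one_lt_d9.le
          _ ≤ 200 := by norm_num
      push_cast
      rw [mul_div_assoc, hγn]
      calc (2 * (k : ℝ) + 1) * ((2 * k + 1) * (exp 4 * t / k))
          ≤ (2 * (k : ℝ) + 1) * ((2 * k + 1) * (200 * t / 1)) := by gcongr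
        _ = 200 * (2 * (k : ℝ) + 1) ^ 2 * t := by ring
        _ ≤ 1 := hsmall
    calc _ ≤ (n * exp ((2 * k + 1) * γ / n)) ^ (2 * k + 1) := by gcongr
      _ = n ^ (2 * k + 1) * exp (((2 * k + 1 : ℕ) : ℝ) * ((2 * k + 1) * γ / n)) := by
        rw [mul_pow, ← exp_nat_mul]
      _ ≤ _ := by gcongr
  rw [← Finset.mul_sum]
  have hfac : (0 : ℝ) < (k.factorial : ℝ) ^ 2 := by positivity
  calc _ ≤ 2 * exp 1 * (1 / 2 : ℝ) ^ (2 * k + 1).choose 2 * exp (-(2 * k)) *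
        (n ^ (2 * k + 1) * exp 1 / (k.factorial : ℝ) ^ 2) := by
        gcongr
        exact hsum.trans (by gcongr)
    _ = 2 * exp 1 * exp 1 * ((n ^ (2 * k + 1) * (1 / 2 : ℝ) ^ (2 * k + 1).choose 2) *
        exp (-(2 * k)) / (k.factorial : ℝ) ^ 2) := by ring
    _ ≤ 2 * exp 1 * exp 1 * 1 := by
        rw [card_pow_mul_half_pow hn]
        gcongr
        rw [div_le_one hfac]
        exact pow_mul_exp_le_factorial_sq k
    _ = _ := mul_one _

/-- Total contribution of the pairs of candidates that agree up to few vertices. -/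
lemma sum_pow_difference_le (ht : 0 < t) (hq : t ^ 4 = (1 / 2 : ℝ) ^ k)
    (hsmall : 200 * (2 * (k : ℝ) + 1) ^ 2 * t ≤ 1) (hn : Fintype.card V = 2 ^ k * k)
    {X₁ X₂ : Finset V} (h₁ : X₁.card = k) (h₂ : X₂.card = k) (x : V) :
    ∑ c' ∈ candidates V k,
        (t ^ 7) ^ (X₁ \ c'.1).card * (t ^ 7) ^ (X₂ \ c'.2.1).card *
          (if x = c'.2.2 then 1 else t ^ 7) ≤ 2 * exp 1 := by
  obtain ⟨hk, ht1, hkt, -⟩ := smallness ht hq hsmall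
  have h := sum_candidates_le (V := V) (k := k) (φ := fun Y => (t ^ 7) ^ (X₁ \ Y).card)
    (ψ := fun Y => (t ^ 7) ^ (X₂ \ Y).card) (χ := fun y => if x = y then 1 else t ^ 7)
    (fun X => by positivity) (fun X => by positivity) (fun x => by split_ifs <;> positivity)
  have hcard := card_mul_pow_four (V := V) hq hn
  have hset : ∀ X : Finset V, X.card = k →
      ∑ Y ∈ Finset.powersetCard k Finset.univ, (t ^ 7) ^ (X \ Y).card ≤ exp (1 / 2) := by
    intro X hX
    have h1 := sum_pow_card_sdiff_le hX (α := t ^ 2) (β := t ^ 5) (by positivity) (by positivity)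
    rw [← pow_add] at h1
    refine h1.trans ?_
    have h2 : 1 + t ^ 2 ≤ exp (t ^ 2) := by linarith [add_one_le_exp (t ^ 2)]
    have h3 : 1 + t ^ 5 ≤ exp (t ^ 5) := by linarith [add_one_le_exp (t ^ 5)]
    calc _ ≤ exp (t ^ 2) ^ k * exp (t ^ 5) ^ Fintype.card V := by gcongr
      _ = exp (k * t ^ 2 + Fintype.card V * t ^ 5) := by
        rw [exp_add, exp_nat_mul, exp_nat_mul]
      _ ≤ _ := by
        rw [exp_le_exp]
        have e1 : (Fintype.card V : ℝ) * t ^ 5 = k * t := by rw [← hcard]; ring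
        rw [e1]
        nlinarith
  have hpt := sum_ite_eq_le x (δ := t ^ 7) (by positivity)
  have hpt' : (1 : ℝ) + Fintype.card V * t ^ 7 ≤ 2 := by
    have e1 : (Fintype.card V : ℝ) * t ^ 7 = k * t * t ^ 2 := by rw [← hcard]; ring
    have e2 : t ^ 2 ≤ 1 := pow_le_one₀ ht.le (by linarith)
    rw [e1]
    nlinarith [mul_pos ht ht]
  refine h.trans ?_
  calc _ ≤ exp (1 / 2) * exp (1 / 2) * 2 :=
        mul_le_mul (mul_le_mul (hset X₁ h₁) (hset X₂ h₂)
          (Finset.sum_nonneg fun _ _ => by positivity) (exp_pos _).le) (hpt.trans hpt')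
          (Finset.sum_nonneg fun y _ => by split_ifs <;> positivity) (by positivity)
    _ = _ := by rw [← exp_add]; norm_num; ring

lemma sum_bitProb_configEvent_inter_le (ht : 0 < t) (hq : t ^ 4 = (1 / 2 : ℝ) ^ k)
    (hsmall : 200 * (2 * (k : ℝ) + 1) ^ 2 * t ≤ 1) (hn : Fintype.card V = 2 ^ k * k)
    {c : Finset V × Finset V × V} (hc : c ∈ candidates V k) :
    ∑ c' ∈ candidates V k, bitProb (configEvent c ∩ configEvent c') ≤
      configProb (Fintype.card V) k * 100 := by
  obtain ⟨hk, ht1, hkt, -⟩ := smallness ht hq hsmall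
  have hp : 0 ≤ configProb (Fintype.card V) k := by
    unfold configProb; positivity
  obtain ⟨⟨h₁, h₂⟩, -⟩ := mem_candidates.1 hc
  set g₁ : Finset V × Finset V × V → ℝ := fun c' =>
    2 * exp 1 * (1 / 2 : ℝ) ^ (2 * k + 1).choose 2 * exp (-(2 * k)) *
      (exp 4 / t ^ 3) ^ (support c ∩ support c').card
  set g₂ : Finset V × Finset V × V → ℝ := fun c' =>
    (t ^ 7) ^ (c.1 \ c'.1).card * (t ^ 7) ^ (c.2.1 \ c'.2.1).card *
      (if c.2.2 = c'.2.2 then 1 else t ^ 7)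
  set g₃ : Finset V × Finset V × V → ℝ := fun c' =>
    (t ^ 7) ^ (c.2.1 \ c'.1).card * (t ^ 7) ^ (c.1 \ c'.2.1).card *
      (if c.2.2 = c'.2.2 then 1 else t ^ 7)
  have hite : ∀ y, (0 : ℝ) ≤ if c.2.2 = y then 1 else t ^ 7 := fun y => by
    split_ifs <;> positivity
  have hg₁ : ∀ c', 0 ≤ g₁ c' := fun c' => by positivity
  have hg₂ : ∀ c', 0 ≤ g₂ c' := fun c' => mul_nonneg (by positivity) (hite _)
  have hg₃ : ∀ c', 0 ≤ g₃ c' := fun c' => mul_nonneg (by positivity) (hite _)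
  have hpair : ∀ c' ∈ candidates V k, bitProb (configEvent c ∩ configEvent c') ≤
      configProb (Fintype.card V) k * (g₁ c' + 2 * g₂ c' + 2 * g₃ c') := by
    intro c' hc'
    by_cases hm : 2 * (support c ∩ support c').card ≤ 3 * k + 2
    · refine (bitProb_configEvent_inter_le_of_card_le ht hq hsmall hn hc hc' hm).trans ?_
      gcongr
      change g₁ c' ≤ _
      linarith [hg₂ c', hg₃ c']
    · push Not at hm
      by_cases hne : (configEvent c ∩ configEvent c').Nonempty
      · have hlarge : k + 1 < (support c ∩ support c').card := by omega
        rcases card_overlap_add_le_of_nonempty hc hc' hne hlarge with hd | hd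
        · refine (bitProb_configEvent_inter_le_of_lt_card ht hq hsmall hc hc' hm hd).trans ?_
          gcongr
          have : (t ^ 7) ^ ((c.1 \ c'.1).card + (c.2.1 \ c'.2.1).card +
              if c.2.2 = c'.2.2 then 0 else 1) = g₂ c' := by
            simp only [g₂, pow_add]; split_ifs <;> simp
          rw [this]
          linarith [hg₁ c', hg₃ c']
        · refine (bitProb_configEvent_inter_le_of_lt_card ht hq hsmall hc hc' hm hd).trans ?_
          gcongr
          have : (t ^ 7) ^ ((c.1 \ c'.2.1).card + (c.2.1 \ c'.1).card +
              if c.2.2 = c'.2.2 then 0 else 1) = g₃ c' := by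
            simp only [g₃, pow_add]; rw [mul_comm ((t ^ 7) ^ (c.1 \ c'.2.1).card)]
            split_ifs <;> simp
          rw [this]
          linarith [hg₁ c', hg₂ c']
      · rw [Set.not_nonempty_iff_eq_empty.1 hne]
        have h0 : bitProb (∅ : Set (Sym2 V → Bool)) = 0 := by simp [bitProb]
        rw [h0]
        exact mul_nonneg hp (by linarith [hg₁ c', hg₂ c', hg₃ c'])
  have s₁ : ∑ c' ∈ candidates V k, g₁ c' ≤ _ := sum_pow_overlap_le ht hq hsmall hn hc
  have s₂ : ∑ c' ∈ candidates V k, g₂ c' ≤ _ := sum_pow_difference_le ht hq hsmall hn h₁ h₂ c.2.2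
  have s₃ : ∑ c' ∈ candidates V k, g₃ c' ≤ _ := sum_pow_difference_le ht hq hsmall hn h₂ h₁ c.2.2
  refine (Finset.sum_le_sum hpair).trans ?_
  rw [← Finset.mul_sum]
  gcongr
  have hsplit : ∑ c' ∈ candidates V k, (g₁ c' + 2 * g₂ c' + 2 * g₃ c') =
      ∑ c' ∈ candidates V k, g₁ c' + 2 * ∑ c' ∈ candidates V k, g₂ c' +
        2 * ∑ c' ∈ candidates V k, g₃ c' := by
    simp only [Finset.sum_add_distrib, Finset.mul_sum]
  rw [hsplit]
  have he := exp_one_lt_d9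
  nlinarith [exp_pos 1]

lemma le_card_candidates_mul_configProb (ht : 0 < t) (hq : t ^ 4 = (1 / 2 : ℝ) ^ k)
    (hsmall : 200 * (2 * (k : ℝ) + 1) ^ 2 * t ≤ 1) (hn : Fintype.card V = 2 ^ k * k) :
    1 / 60 ≤ ((candidates V k).card : ℝ) * configProb (Fintype.card V) k := by
  obtain ⟨hk, ht1, hkt, hst⟩ := smallness ht hq hsmall
  have hk1 : (1 : ℝ) ≤ k := by exact_mod_cast Nat.one_le_iff_ne_zero.2 hk
  have hk2 : 2 ≤ 2 ^ k := by
    calc 2 = 2 ^ 1 := rfl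
      _ ≤ 2 ^ k := Nat.pow_le_pow_right (by norm_num) (Nat.one_le_iff_ne_zero.2 hk)
  have hcard := card_mul_pow_four (V := V) hq hn
  have hM := pow_div_factorial_le_card_candidates (V := V) (k := k) (by rw [hn]; gcongr)
  have ht4 : t ^ 4 ≤ t := by
    calc t ^ 4 ≤ t ^ 1 := pow_le_pow_of_le_one ht.le (by linarith) (by norm_num)
      _ = t := pow_one t
  have ht40 : 0 < t ^ 4 := by positivity
  have hexp : exp (-(2 * k)) * exp (-1) ≤
      ((1 - (1 / 2 : ℝ) ^ k) ^ 2) ^ (Fintype.card V - (2 * k + 1)) := by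
    have h1 : exp (-(t ^ 4 / (1 - t ^ 4))) ≤ 1 - t ^ 4 := by
      rw [exp_neg, inv_le_comm₀ (exp_pos _) (by linarith)]
      refine le_trans (le_of_eq ?_) (add_one_le_exp _)
      have : 1 - t ^ 4 ≠ 0 := by linarith
      field_simp
      ring
    rw [← hq]
    calc _ = exp (-(2 * k) + -1) := (exp_add _ _).symm
      _ ≤ exp (((2 * Fintype.card V : ℕ) : ℝ) * -(t ^ 4 / (1 - t ^ 4))) := by
        rw [exp_le_exp]
        push_cast
        have h2 : (Fintype.card V : ℝ) * (t ^ 4 / (1 - t ^ 4)) = k / (1 - t ^ 4) := by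
          rw [← mul_div_assoc, hcard]
        have h3 : (k : ℝ) / (1 - t ^ 4) ≤ k + 1 / 2 := by
          rw [div_le_iff₀ (by linarith)]
          nlinarith
        linarith
      _ = exp (-(t ^ 4 / (1 - t ^ 4))) ^ (2 * Fintype.card V) := exp_nat_mul _ _
      _ ≤ (1 - t ^ 4) ^ (2 * Fintype.card V) := by gcongr
      _ = ((1 - t ^ 4) ^ 2) ^ Fintype.card V := pow_mul _ _ _
      _ ≤ _ := by
        refine pow_le_pow_of_le_one (by positivity) ?_ (Nat.sub_le _ _)
        apply pow_le_one₀ <;> linarith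
  set n : ℝ := (Fintype.card V : ℝ) with hn'
  have hn0 : 0 < n := by rw [hn', hn]; push_cast; positivity
  have hpow : n ^ (2 * k + 1) / 2 ≤ (n - 2 * k) ^ (2 * k + 1) := by
    have h1 : n - 2 * k = n * (1 + -(2 * t ^ 4)) := by rw [← hcard]; ring
    have h2 := one_add_mul_le_pow (a := -(2 * t ^ 4)) (by linarith) (2 * k + 1)
    rw [h1, mul_pow, div_eq_mul_one_div]
    gcongr
    refine le_trans ?_ h2
    push_cast
    nlinarith
  have hfac := factorial_sq_le hk
  have hfac0 : (0 : ℝ) < (k.factorial : ℝ) ^ 2 := by positivity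
  calc (1 : ℝ) / 60 ≤ exp (-1) / 2 * exp (-2) := by
        have h3 : exp (-1) / 2 * exp (-2) = 1 / (2 * exp 1 ^ 3) := by
          rw [← exp_nat_mul, exp_neg, exp_neg]
          rw [show ((3 : ℕ) : ℝ) * 1 = 1 + 2 by norm_num, exp_add]
          field_simp
        rw [h3]
        have h4 : exp 1 ^ 3 ≤ 2.7182818286 ^ 3 := by gcongr; exact exp_one_lt_d9.le
        apply one_div_le_one_div_of_le (by positivity)
        norm_num at h4 ⊢
        linarith
    _ ≤ exp (-1) / 2 * ((k : ℝ) ^ (2 * k + 1) * exp (-(2 * k)) / (k.factorial : ℝ) ^ 2) := by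
        gcongr
        rw [le_div_iff₀ hfac0, exp_neg 2, inv_mul_le_iff₀ (exp_pos 2)]
        exact hfac
    _ = (n ^ (2 * k + 1) / 2) / (k.factorial : ℝ) ^ 2 *
        ((1 / 2 : ℝ) ^ (2 * k + 1).choose 2 * (exp (-(2 * k)) * exp (-1))) := by
        rw [← card_pow_mul_half_pow (V := V) hn]; ring
    _ ≤ (n - 2 * k) ^ (2 * k + 1) / (k.factorial : ℝ) ^ 2 *
        ((1 / 2 : ℝ) ^ (2 * k + 1).choose 2 *
          ((1 - (1 / 2 : ℝ) ^ k) ^ 2) ^ (Fintype.card V - (2 * k + 1))) := by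
        gcongr
        exact (by positivity : 0 ≤ n ^ (2 * k + 1) / 2 / (k.factorial : ℝ) ^ 2).trans
          (div_le_div_of_nonneg_right hpow hfac0.le)
    _ ≤ _ := by
        rw [configProb]
        have : 0 ≤ (1 / 2 : ℝ) ^ (2 * k + 1).choose 2 *
          ((1 - (1 / 2 : ℝ) ^ k) ^ 2) ^ (Fintype.card V - (2 * k + 1)) := by positivity
        exact mul_le_mul_of_nonneg_right hM this

lemma le_bitProb_exists_configEvent (ht : 0 < t) (hq : t ^ 4 = (1 / 2 : ℝ) ^ k)
    (hsmall : 200 * (2 * (k : ℝ) + 1) ^ 2 * t ≤ 1) (hn : Fintype.card V = 2 ^ k * k) :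
    1 / 6000 ≤ bitProb {f : Sym2 V → Bool | ∃ c ∈ candidates V k, f ∈ configEvent c} := by
  have hfirst := le_card_candidates_mul_configProb (V := V) ht hq hsmall hn
  have hmom := sq_sum_bitProb_le (candidates V k) configEvent
  set P := bitProb {f : Sym2 V → Bool | ∃ c ∈ candidates V k, f ∈ configEvent c}
  have hP : 0 ≤ P := bitProb_nonneg _
  have hsum : ∑ c ∈ candidates V k, bitProb (configEvent c) =
      (candidates V k).card * configProb (Fintype.card V) k := by
    rw [Finset.sum_congr rfl fun c hc => bitProb_configEvent hc]
    simp [configProb]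
  have hsecond : ∑ c ∈ candidates V k, ∑ c' ∈ candidates V k,
      bitProb (configEvent c ∩ configEvent c') ≤
        100 * ((candidates V k).card * configProb (Fintype.card V) k) := by
    refine (Finset.sum_le_sum fun c hc =>
      sum_bitProb_configEvent_inter_le ht hq hsmall hn hc).trans (le_of_eq ?_)
    simp; ring
  rw [hsum] at hmom
  set m := ((candidates V k).card : ℝ) * configProb (Fintype.card V) k
  have h := hmom.trans (mul_le_mul_of_nonneg_left hsecond hP)
  have : m ≤ 100 * P := by
    refine le_of_mul_le_mul_right ?_ (by linarith : 0 < m)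
    nlinarith
  linarith

end Asymptotics

lemma isConfig_of_mem_configEvent {n k : ℕ} (hk : k ≠ 0)
    {c : Finset (Fin n) × Finset (Fin n) × Fin n} (hc : c ∈ candidates (Fin n) k)
    {f : Sym2 (Fin n) → Bool} (hf : f ∈ configEvent c) :
    IsConfig (bitGraph f) c.1 c.2.1 c.2.2 := by
  obtain ⟨⟨h1, h2⟩, hd, hx, hx'⟩ := mem_candidates.1 hc
  obtain ⟨hcore, hdom⟩ := hf
  have hXd : ∀ w, w ∈ c.1 → w ∈ c.2.1 → False := fun w h h' => Finset.disjoint_left.1 hd h h'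
  have hadj : ∀ u ∈ support c, ∀ v ∈ support c, u ≠ v →
      ((bitGraph f).Adj u v ↔ ¬ ((u ∈ c.1 ∧ v ∈ c.2.1) ∨ (v ∈ c.1 ∧ u ∈ c.2.1))) := by
    intro u hu v hv huv
    rw [← pattern_eq_false_iff, ← hcore _ (mem_edgesWithin.2 ⟨hu, hv, huv⟩)]
    simp [bitGraph, huv]
  have i1 := inl_subset_support c
  have i2 := inr_subset_support c
  have ix := apex_mem_support c
  have ne1 : c.1.Nonempty := Finset.card_pos.1 (by omega)
  have ne2 : c.2.1.Nonempty := Finset.card_pos.1 (by omega)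
  have a1 : ∀ u ∈ c.1, (bitGraph f).Adj c.2.2 u := fun u hu => by
    rw [hadj _ ix u (i1 hu) (fun h => hx (h ▸ hu))]; tauto
  have a2 : ∀ u ∈ c.2.1, (bitGraph f).Adj c.2.2 u := fun u hu => by
    rw [hadj _ ix u (i2 hu) (fun h => hx' (h ▸ hu))]; tauto
  refine ⟨ne1, ne2, hd, hx, hx', ?_, ?_, ?_, a1, a2, ?_⟩
  · intro u hu v hv huv
    rw [hadj u (i1 hu) v (i1 hv) huv]
    have := hXd u; have := hXd v; tauto
  · intro u hu v hv huv
    rw [hadj u (i2 hu) v (i2 hv) huv]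
    have := hXd u; have := hXd v; tauto
  · intro u hu v hv
    rw [hadj u (i1 hu) v (i2 hv) (fun h => hXd u hu (h ▸ hv))]
    tauto
  · intro y hy1 hy2
    by_cases hy : y = c.2.2
    · subst hy
      exact ⟨ne1.imp fun u hu => ⟨hu, a1 u hu⟩, ne2.imp fun u hu => ⟨hu, a2 u hu⟩⟩
    · obtain ⟨⟨a, ha, ha'⟩, b, hb, hb'⟩ :=
        mem_dominatedEvent.1 (hdom y (by simp [support, hy, hy1, hy2]))
      refine ⟨⟨a, ha, ?_⟩, b, hb, ?_⟩
      · simp only [bitGraph, SimpleGraph.fromEdgeSet_adj]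
        exact ⟨ha', fun h => hy1 (h ▸ ha)⟩
      · simp only [bitGraph, SimpleGraph.fromEdgeSet_adj]
        exact ⟨hb', fun h => hy2 (h ▸ hb)⟩

lemma bitProb_bitGraph_le_unifProb (n : ℕ) (Q : SimpleGraph (Fin n) → Prop) :
    bitProb {f : Sym2 (Fin n) → Bool | Q (bitGraph f)} ≤ unifProb n Q := by
  have hinj : Function.Injective fun f : {f : Sym2 (Fin n) → Bool // Q (bitGraph f)} =>
      ((⟨bitGraph f.1, f.2⟩, fun v => f.1 s(v, v)) :
        {G : SimpleGraph (Fin n) // Q G} × (Fin n → Bool)) := by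
    rintro ⟨f, hf⟩ ⟨g, hg⟩ h
    simp only [Prod.mk.injEq, Subtype.mk.injEq] at h ⊢
    funext e
    induction e with | _ u v =>
    by_cases huv : u = v
    · subst huv; exact congrFun h.2 u
    · have := congrArg (fun G => G.Adj u v) h.1
      simp only [bitGraph, SimpleGraph.fromEdgeSet_adj, ne_eq, huv, not_false_eq_true, and_true,
        Set.mem_ofPred_eq, eq_iff_iff] at this
      exact Bool.eq_iff_iff.2 this
  have hle := Nat.card_le_card_of_injective _ hinj
  rw [Nat.card_prod, Nat.card_fun, Nat.card_fin, show Nat.card Bool = 2 by simp] at hle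
  have hcard : Fintype.card (Sym2 (Fin n)) = n.choose 2 + n := by
    rw [Sym2.card, Fintype.card_fin, Nat.choose_succ_succ' n 1, Nat.choose_one_right, Nat.add_comm]
  rw [bitProb, unifProb, hcard, pow_add, div_le_div_iff₀ (by positivity) (by positivity)]
  have hle' : ((Nat.card {f : Sym2 (Fin n) → Bool // Q (bitGraph f)} : ℕ) : ℝ) ≤
      (Nat.card {G : SimpleGraph (Fin n) // Q G} : ℝ) * 2 ^ n := by exact_mod_cast hle
  calc _ ≤ ((Nat.card {G : SimpleGraph (Fin n) // Q G} : ℝ) * 2 ^ n) * 2 ^ n.choose 2 := by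
        gcongr
        exact hle'
    _ = _ := by ring

lemma unifProb_le_one (n : ℕ) (Q : SimpleGraph (Fin n) → Prop) : unifProb n Q ≤ 1 := by
  have hinj : Function.Injective fun G : {G : SimpleGraph (Fin n) // Q G} =>
      {e : {e : Sym2 (Fin n) // ¬ e.IsDiag} | e.1 ∈ G.1.edgeSet} := by
    intro G H h
    refine Subtype.ext (SimpleGraph.ext (funext₂ fun u v => propext ?_))
    by_cases huv : u = v
    · simp [huv]
    · have := Set.ext_iff.1 h ⟨s(u, v), by simpa using huv⟩
      simpa using this
  have hle := Nat.card_le_card_of_injective _ hinj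
  rw [Nat.card_eq_fintype_card (α := Set _), Fintype.card_set, Sym2.card_subtype_not_diag,
    Fintype.card_fin] at hle
  rw [unifProb, div_le_one (by positivity)]
  exact_mod_cast hle

lemma eventually_small : ∃ a : ℝ, 0 < a ∧ a ^ 4 = 1 / 2 ∧
    ∀ᶠ k : ℕ in atTop, 200 * (2 * (k : ℝ) + 1) ^ 2 * a ^ k ≤ 1 := by
  refine ⟨√√(1 / 2), by positivity, ?_, ?_⟩
  · rw [show 4 = 2 * 2 from rfl, pow_mul, Real.sq_sqrt (by positivity), Real.sq_sqrt (by norm_num)]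
  · have ha : |√√(1 / 2 : ℝ)| < 1 := by
      rw [abs_of_nonneg (by positivity), Real.sqrt_lt' one_pos, one_pow, Real.sqrt_lt' one_pos]
      norm_num
    have h := (((tendsto_pow_const_mul_const_pow_of_abs_lt_one 2 ha).const_mul 800).add
      ((tendsto_pow_const_mul_const_pow_of_abs_lt_one 1 ha).const_mul 800)).add
      ((tendsto_pow_const_mul_const_pow_of_abs_lt_one 0 ha).const_mul 200)
    norm_num only [mul_zero, add_zero] at h
    filter_upwards [h.eventually_le_const (zero_lt_one (α := ℝ))] with k hk
    refine le_trans (le_of_eq ?_) hk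
    ring

/-- Along the subsequence `n_k = 2^k k`, the probability that the
uniform random graph has property `P` has strictly positive lower limit. -/
theorem liminf_prob_propertyP_pos :
    0 < Filter.liminf (fun k : ℕ => unifProb (2 ^ k * k) PropertyP) atTop := by
  obtain ⟨a, ha, ha4, hsmall⟩ := eventually_small
  have hbound : ∀ᶠ k : ℕ in atTop, 1 / 6000 ≤ unifProb (2 ^ k * k) PropertyP := by
    filter_upwards [hsmall, eventually_ne_atTop 0] with k hk hk0
    have hq : (a ^ k) ^ 4 = (1 / 2 : ℝ) ^ k := by rw [← pow_mul, mul_comm, pow_mul, ha4]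
    refine (le_bitProb_exists_configEvent (V := Fin (2 ^ k * k)) (by positivity) hq hk
      (Fintype.card_fin _)).trans ((bitProb_mono ?_).trans (bitProb_bitGraph_le_unifProb _ _))
    rintro f ⟨c, hc, hf⟩
    exact ⟨c.1, c.2.1, c.2.2, isConfig_of_mem_configEvent hk0 hc hf⟩
  refine lt_of_lt_of_le (by norm_num : (0 : ℝ) < 1 / 6000) (le_liminf_of_le ?_ hbound)
  exact (isBoundedUnder_of ⟨1, fun k => unifProb_le_one _ _⟩).isCoboundedUnder_ge
end

section
/- For all integers k, l ≥ 1 with k + l + 1 ≤ n, the expectation of X(k,l) under G(n,1/2) satisfies E X(k,l) ≤ (n^{k+l+1} · e^{k+l} / (k^k · l^l)) · 2^{−(k+l)²/2 − (k+l)/2} · e^{−(n−k−l−1)(2^{−k} + 2^{−l})}. -/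
open Filter Real

/-- `Xcount n k l G` is the number of ordered triples `(X₁, X₂, x)` forming a
configuration in `G` with `|X₁| = k` and `|X₂| = l`. -/
noncomputable def Xcount (n k l : ℕ) (G : SimpleGraph (Fin n)) : ℕ :=
  Nat.card {t : Finset (Fin n) × Finset (Fin n) × Fin n //
    t.1.card = k ∧ t.2.1.card = l ∧ IsConfig G t.1 t.2.1 t.2.2}

/-- The expectation of a random variable `Y` under the uniform distribution on graphs
on `{1, …, n}`. -/
noncomputable def expect (n : ℕ) (Y : SimpleGraph (Fin n) → ℝ) : ℝ :=
  (∑ G : SimpleGraph (Fin n), Y G) / 2 ^ (n.choose 2)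

/-- The number of simple graphs on a finite type with `N` elements is at most `2 ^ (N.choose 2)`. -/
theorem card_simpleGraph_le (V : Type*) [Fintype V] [DecidableEq V] :
    Nat.card (SimpleGraph V) ≤ 2 ^ (Fintype.card V).choose 2 := by
  have hinj : Function.Injective
      (fun (G : SimpleGraph V) => {e : {e : Sym2 V // ¬ e.IsDiag} | e.1 ∈ G.edgeSet}) := by
    intro G H h
    rw [← SimpleGraph.edgeSet_inj]
    ext e
    by_cases he : e.IsDiag
    · exact ⟨fun h' => absurd he (G.not_isDiag_of_mem_edgeSet h'),
        fun h' => absurd he (H.not_isDiag_of_mem_edgeSet h')⟩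
    · exact Set.ext_iff.mp h ⟨e, he⟩
  have hle := Nat.card_le_card_of_injective _ hinj
  rwa [Nat.card_eq_fintype_card (α := Set _), Fintype.card_set, Sym2.card_subtype_not_diag] at hle

/-- The number of graphs in which a fixed triple is a configuration is bounded by the number of
ways to choose nonempty neighborhoods in `X₁` and in `X₂` for every remaining vertex, and a graph
on the complement of `X₁ ∪ X₂`. -/
theorem card_isConfig_le {n k l m : ℕ} (hn : n = k + l + m + 1) {X₁ X₂ : Finset (Fin n)}
    (h₁ : X₁.card = k) (h₂ : X₂.card = l) (x : Fin n) :
    Nat.card {G : SimpleGraph (Fin n) // IsConfig G X₁ X₂ x} ≤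
      (2 ^ k - 1) ^ m * (2 ^ l - 1) ^ m * 2 ^ (m + 1).choose 2 := by
  classical
  rcases isEmpty_or_nonempty {G : SimpleGraph (Fin n) // IsConfig G X₁ X₂ x} with hE | ⟨⟨G₀, hG₀⟩⟩
  · simp
  obtain ⟨-, -, hdisj, hx₁, hx₂, -⟩ := hG₀
  let W : Finset (Fin n) := (X₁ ∪ X₂)ᶜ
  let R : Finset (Fin n) := W.erase x
  have hxW : x ∈ W := by simp [W, hx₁, hx₂]
  have hW : W.card = m + 1 := by
    rw [Finset.card_compl, Finset.card_union_of_disjoint hdisj, Fintype.card_fin]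
    omega
  have hR : R.card = m := by rw [Finset.card_erase_of_mem hxW, hW]; rfl
  have hmem : ∀ y ∈ R, y ∉ X₁ ∧ y ∉ X₂ := by
    intro y hy
    simpa [R, W] using (Finset.mem_erase.mp hy).2
  let N (X : Finset (Fin n)) := {A : Finset (Fin n) // A ∈ X.powerset.erase ∅}
  have hN : ∀ X : Finset (Fin n), Nat.card (N X) = 2 ^ X.card - 1 := by
    intro X
    rw [Nat.card_eq_fintype_card, Fintype.card_coe,
      Finset.card_erase_of_mem (Finset.empty_mem_powerset X), Finset.card_powerset]
  let f : {G : SimpleGraph (Fin n) // IsConfig G X₁ X₂ x} →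
      (R → N X₁) × (R → N X₂) × SimpleGraph W := fun G =>
    (fun y => ⟨X₁.filter (G.1.Adj y), by
        obtain ⟨u, hu, ha⟩ := (G.2.2.2.2.2.2.2.2.2.2.2 y (hmem y y.2).1 (hmem y y.2).2).1
        simp only [Finset.mem_erase, Finset.mem_powerset, Finset.filter_subset, and_true]
        exact Finset.ne_empty_of_mem (Finset.mem_filter.mpr ⟨hu, ha⟩)⟩,
      fun y => ⟨X₂.filter (G.1.Adj y), by
        obtain ⟨u, hu, ha⟩ := (G.2.2.2.2.2.2.2.2.2.2.2 y (hmem y y.2).1 (hmem y y.2).2).2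
        simp only [Finset.mem_erase, Finset.mem_powerset, Finset.filter_subset, and_true]
        exact Finset.ne_empty_of_mem (Finset.mem_filter.mpr ⟨hu, ha⟩)⟩,
      G.1.comap Subtype.val)
  have hf : Function.Injective f := by
    rintro ⟨G, hG⟩ ⟨H, hH⟩ hGH
    simp only [f, Prod.mk.injEq, funext_iff, Subtype.mk.injEq] at hGH
    obtain ⟨e₁, e₂, e₃⟩ := hGH
    obtain ⟨-, -, -, -, -, gc₁, gc₂, gn, gx₁, gx₂, -⟩ := hG
    obtain ⟨-, -, -, -, -, hc₁, hc₂, hn, hx₁, hx₂, -⟩ := hH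
    have cross : ∀ y ∈ W, ∀ v ∉ W, G.Adj y v ↔ H.Adj y v := by
      intro y hy v hv
      have hv : v ∈ X₁ ∨ v ∈ X₂ := by simpa [W, -not_or, ← or_iff_not_imp_left] using hv
      by_cases hyx : y = x
      · subst hyx
        rcases hv with hv | hv
        · simp [gx₁ v hv, hx₁ v hv]
        · simp [gx₂ v hv, hx₂ v hv]
      · have hyR : y ∈ R := Finset.mem_erase.mpr ⟨hyx, hy⟩
        rcases hv with hv | hv
        · simpa [hv] using Finset.ext_iff.mp (e₁ ⟨y, hyR⟩) v
        · simpa [hv] using Finset.ext_iff.mp (e₂ ⟨y, hyR⟩) v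
    refine Subtype.ext (SimpleGraph.ext ?_)
    funext u v
    refine propext ?_
    change G.Adj u v ↔ H.Adj u v
    by_cases hu : u ∈ W <;> by_cases hv : v ∈ W
    · have := congrArg (fun K : SimpleGraph W => K.Adj ⟨u, hu⟩ ⟨v, hv⟩) e₃
      simpa using this
    · exact cross u hu v hv
    · rw [G.adj_comm, H.adj_comm]
      exact cross v hv u hu
    · rcases eq_or_ne u v with rfl | huv
      · simp
      have hu : u ∈ X₁ ∨ u ∈ X₂ := by simpa [W, -not_or, ← or_iff_not_imp_left] using hu
      have hv : v ∈ X₁ ∨ v ∈ X₂ := by simpa [W, -not_or, ← or_iff_not_imp_left] using hv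
      rcases hu with hu | hu <;> rcases hv with hv | hv
      · simp [gc₁ u hu v hv huv, hc₁ u hu v hv huv]
      · simp [gn u hu v hv, hn u hu v hv]
      · rw [G.adj_comm, H.adj_comm]
        simp [gn v hv u hu, hn v hv u hu]
      · simp [gc₂ u hu v hv huv, hc₂ u hu v hv huv]
  have hS := card_simpleGraph_le W
  rw [Fintype.card_coe, hW] at hS
  calc _ ≤ _ := Nat.card_le_card_of_injective f hf
    _ = (2 ^ k - 1) ^ m * ((2 ^ l - 1) ^ m * Nat.card (SimpleGraph W)) := by
      rw [Nat.card_prod, Nat.card_prod, Nat.card_fun, Nat.card_fun, hN, hN, h₁, h₂,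
        Nat.card_eq_fintype_card (α := R), Fintype.card_coe, hR]
    _ ≤ _ := by rw [mul_assoc]; gcongr

/-- Exchanging the order of summation: a uniform bound on the number of graphs in which a fixed
triple is a configuration bounds the total number of configurations over all graphs. -/
theorem sum_Xcount_le {n k l B : ℕ}
    (hB : ∀ X₁ X₂ : Finset (Fin n), X₁.card = k → X₂.card = l → ∀ x,
      Nat.card {G : SimpleGraph (Fin n) // IsConfig G X₁ X₂ x} ≤ B) :
    ∑ G : SimpleGraph (Fin n), Xcount n k l G ≤ n.choose k * n.choose l * n * B := by
  classical
  let T : Finset (Finset (Fin n) × Finset (Fin n) × Fin n) :=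
    Finset.univ.powersetCard k ×ˢ Finset.univ.powersetCard l ×ˢ Finset.univ
  have hX : ∀ G : SimpleGraph (Fin n), Xcount n k l G =
      ∑ t ∈ T, if IsConfig G t.1 t.2.1 t.2.2 then 1 else 0 := by
    intro G
    rw [Xcount, Nat.card_eq_fintype_card, Fintype.card_subtype, ← Finset.card_filter]
    congr 1
    ext t
    simp [T, and_assoc]
  simp_rw [hX]
  rw [Finset.sum_comm]
  calc _ ≤ ∑ _t ∈ T, B := by
        refine Finset.sum_le_sum fun t ht => ?_
        simp only [T, Finset.mem_product, Finset.mem_powersetCard_univ, Finset.mem_univ,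
          and_true] at ht
        rw [← Finset.card_filter, ← Fintype.card_subtype, ← Nat.card_eq_fintype_card]
        exact hB _ _ ht.1 ht.2 _
    _ = _ := by simp [T, mul_assoc]

theorem choose_le_pow_mul_exp_div {n k : ℕ} (hk : 1 ≤ k) :
    (n.choose k : ℝ) ≤ (n : ℝ) ^ k * Real.exp k / (k : ℝ) ^ k := by
  have hk' : (0 : ℝ) < k := by exact_mod_cast hk
  have hexp : (k : ℝ) ^ k / (k.factorial : ℝ) ≤ Real.exp k :=
    Real.pow_div_factorial_le_exp (k : ℝ) hk'.le k
  calc (n.choose k : ℝ) ≤ (n : ℝ) ^ k / (k.factorial : ℝ) := Nat.choose_le_pow_div k n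
    _ = (n : ℝ) ^ k * ((k : ℝ) ^ k / (k.factorial : ℝ)) / (k : ℝ) ^ k := by
      field_simp
    _ ≤ _ := by gcongr

theorem two_pow_sub_one_le (k : ℕ) :
    ((2 ^ k - 1 : ℕ) : ℝ) ≤ 2 ^ k * Real.exp (-(2 : ℝ) ^ (-(k : ℝ))) := by
  have h : 1 - (2 : ℝ) ^ (-(k : ℝ)) ≤ Real.exp (-(2 : ℝ) ^ (-(k : ℝ))) :=
    Real.one_sub_le_exp_neg _
  calc ((2 ^ k - 1 : ℕ) : ℝ) = 2 ^ k * (1 - (2 : ℝ) ^ (-(k : ℝ))) := by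
        rw [Nat.cast_sub Nat.one_le_two_pow, Real.rpow_neg zero_le_two, Real.rpow_natCast,
          mul_sub, mul_inv_cancel₀ (by positivity)]
        simp
    _ ≤ _ := by gcongr

/-- Upper bound on the probability that a fixed triple is a configuration. -/
theorem config_bound_div_le (k l m : ℕ) :
    (((2 ^ k - 1) ^ m * (2 ^ l - 1) ^ m * 2 ^ (m + 1).choose 2 : ℕ) : ℝ) /
        2 ^ (k + l + m + 1).choose 2 ≤
      (2 : ℝ) ^ (-(((k : ℝ) + l) ^ 2) / 2 - ((k : ℝ) + l) / 2) *
        Real.exp (-(m : ℝ) * ((2 : ℝ) ^ (-(k : ℝ)) + (2 : ℝ) ^ (-(l : ℝ)))) := by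
  have hpow : (2 : ℝ) ^ (-(((k : ℝ) + l) ^ 2) / 2 - ((k : ℝ) + l) / 2) *
      2 ^ (k + l + m + 1).choose 2 = (2 ^ k) ^ m * (2 ^ l) ^ m * 2 ^ (m + 1).choose 2 := by
    rw [← pow_mul, ← pow_mul, ← pow_add, ← pow_add,
      ← Real.rpow_natCast 2 ((k + l + m + 1).choose 2), ← Real.rpow_add two_pos,
      ← Real.rpow_natCast 2 (k * m + l * m + (m + 1).choose 2)]
    congr 1
    push_cast [Nat.cast_choose_two]
    ring
  rw [div_le_iff₀ (by positivity), mul_right_comm (2 ^ (_ : ℝ) : ℝ), hpow]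
  have hexp : Real.exp (-(m : ℝ) * ((2 : ℝ) ^ (-(k : ℝ)) + (2 : ℝ) ^ (-(l : ℝ)))) =
      Real.exp (-(2 : ℝ) ^ (-(k : ℝ))) ^ m * Real.exp (-(2 : ℝ) ^ (-(l : ℝ))) ^ m := by
    rw [← Real.exp_nat_mul, ← Real.exp_nat_mul, ← Real.exp_add]
    congr 1
    ring
  calc _ = ((2 ^ k - 1 : ℕ) : ℝ) ^ m * ((2 ^ l - 1 : ℕ) : ℝ) ^ m * 2 ^ (m + 1).choose 2 := by
        rw [Nat.cast_mul, Nat.cast_mul, Nat.cast_pow, Nat.cast_pow, Nat.cast_pow, Nat.cast_ofNat]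
    _ ≤ (2 ^ k * Real.exp (-(2 : ℝ) ^ (-(k : ℝ)))) ^ m *
        (2 ^ l * Real.exp (-(2 : ℝ) ^ (-(l : ℝ)))) ^ m * 2 ^ (m + 1).choose 2 := by
      gcongr <;> exact two_pow_sub_one_le _
    _ = _ := by rw [hexp]; ring

/-- Upper bound on the expectation of `X(k,l)` under `G(n,1/2)`. -/
theorem expect_Xcount_le (n k l : ℕ) (hk : 1 ≤ k) (hl : 1 ≤ l) (hn : k + l + 1 ≤ n) :
    expect n (fun G => (Xcount n k l G : ℝ)) ≤
      (n : ℝ) ^ (k + l + 1) * Real.exp (k + l) / ((k : ℝ) ^ k * (l : ℝ) ^ l) *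
        (2 : ℝ) ^ (-(((k : ℝ) + l) ^ 2) / 2 - ((k : ℝ) + l) / 2) *
        Real.exp (-((n : ℝ) - k - l - 1) * ((2 : ℝ) ^ (-(k : ℝ)) + (2 : ℝ) ^ (-(l : ℝ)))) := by
  obtain ⟨m, hm⟩ : ∃ m, n = k + l + m + 1 := ⟨n - (k + l + 1), by omega⟩
  have hsum := sum_Xcount_le (n := n) (k := k) (l := l)
    fun X₁ X₂ h₁ h₂ x => card_isConfig_le hm h₁ h₂ x
  have hnm : (n : ℝ) - k - l - 1 = m := by rw [hm]; push_cast; ring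
  have hprob := config_bound_div_le k l m
  rw [← hm] at hprob
  rw [hnm, expect, ← Nat.cast_sum]
  calc _ ≤ ((n.choose k * n.choose l * n *
          ((2 ^ k - 1) ^ m * (2 ^ l - 1) ^ m * 2 ^ (m + 1).choose 2) : ℕ) : ℝ) /
          2 ^ n.choose 2 := by
        gcongr
    _ = (n.choose k : ℝ) * n.choose l * n *
        ((((2 ^ k - 1) ^ m * (2 ^ l - 1) ^ m * 2 ^ (m + 1).choose 2 : ℕ) : ℝ) /
          2 ^ n.choose 2) := by
      rw [Nat.cast_mul, Nat.cast_mul, Nat.cast_mul, mul_div_assoc]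
    _ ≤ ((n : ℝ) ^ k * Real.exp k / (k : ℝ) ^ k) * ((n : ℝ) ^ l * Real.exp l / (l : ℝ) ^ l) * n *
        ((2 : ℝ) ^ (-(((k : ℝ) + l) ^ 2) / 2 - ((k : ℝ) + l) / 2) *
          Real.exp (-(m : ℝ) * ((2 : ℝ) ^ (-(k : ℝ)) + (2 : ℝ) ^ (-(l : ℝ))))) := by
      gcongr
      · exact choose_le_pow_mul_exp_div hk
      · exact choose_le_pow_mul_exp_div hl
    _ = _ := by
      rw [Real.exp_add]
      ring
end

section
/- There exists a constant c > 0 such that for all sufficiently large k the following holds with n = ⌊2^{k+1/2} k⌋: for every pair of integers k̃, l̃ ≥ 1 with k̃ + l̃ ≤ n − 1, f(k̃, l̃) − f(k*(n), k*(n)) ≤ −c · ln n; moreover, f(k̃, l̃) − f(k*(n), k*(n)) ≤ −3 · ln n whenever in addition |k̃ − k*(n)| ≥ 5 or |l̃ − k*(n)| ≥ 5. -/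
open Filter Real

/-- The function `f(k,l)` from the proof of Theorem 1 (with parameter `n`):
`f(k,l) = (k+l+1)·ln n − k·ln k − l·ln l + k + l − ((k+l)²/2)·ln 2 − ((k+l)/2)·ln 2
          − (n−k−l)·(2^{−k} + 2^{−l})`, where `2^{−k} = exp(−k·ln 2)`. -/
noncomputable def f (n : ℕ) (k l : ℝ) : ℝ :=
  (k + l + 1) * Real.log n - k * Real.log k - l * Real.log l + k + l
    - ((k + l) ^ 2 / 2) * Real.log 2 - ((k + l) / 2) * Real.log 2
    - ((n : ℝ) - k - l) * (Real.exp (-k * Real.log 2) + Real.exp (-l * Real.log 2))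

/-- The region `R = {(k,l) : k ≥ 1, l ≥ 1, k + l ≤ n − 1}`. -/
def region (n : ℕ) : Set (ℝ × ℝ) :=
  {p : ℝ × ℝ | 1 ≤ p.1 ∧ 1 ≤ p.2 ∧ p.1 + p.2 ≤ (n : ℝ) - 1}

/-- `(k, l)` is a critical point of `f n`: both partial derivatives vanish. -/
def IsCritPt (n : ℕ) (k l : ℝ) : Prop :=
  deriv (fun k' => f n k' l) k = 0 ∧ deriv (fun l' => f n k l') l = 0

/-- The first partial derivative of `f n` at `(k, l)`. -/
noncomputable def fGrad (n : ℕ) (k l : ℝ) : ℝ :=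
  Real.log n - Real.log k - (k + l + 1 / 2) * Real.log 2
    + (Real.exp (-k * Real.log 2) + Real.exp (-l * Real.log 2))
    + ((n : ℝ) - k - l) * Real.log 2 * Real.exp (-k * Real.log 2)

lemma f_comm (n : ℕ) (k l : ℝ) : f n k l = f n l k := by
  unfold f
  ring

lemma hasDerivAt_f (n : ℕ) {k : ℝ} (hk : 0 < k) (l : ℝ) :
    HasDerivAt (fun k' => f n k' l) (fGrad n k l) k := by
  have hid := hasDerivAt_id k
  have hexp := (hid.neg.mul_const (Real.log 2)).exp
  have hlog := hid.mul (Real.hasDerivAt_log hk.ne')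
  have hsum := hid.add_const l
  have h := ((((((((hsum.add_const 1).mul_const (Real.log n)).sub hlog).sub_const
    (l * Real.log l)).add hid).add_const l).sub
      (((hsum.pow 2).div_const 2).mul_const (Real.log 2))).sub
      ((hsum.div_const 2).mul_const (Real.log 2))).sub
      (((hid.const_sub (n : ℝ)).sub_const l).mul
        (hexp.add_const (Real.exp (-l * Real.log 2))))
  refine h.congr_deriv ?_
  simp only [fGrad, id, Pi.neg_apply]
  field_simp
  ring

lemma isCritPt_iff (n : ℕ) {k l : ℝ} (hk : 0 < k) (hl : 0 < l) :
    IsCritPt n k l ↔ fGrad n k l = 0 ∧ fGrad n l k = 0 := by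
  have h : (fun l' => f n k l') = fun l' => f n l' k := funext fun l' => f_comm n k l'
  rw [IsCritPt, h, (hasDerivAt_f n hk l).deriv, (hasDerivAt_f n hl k).deriv]

lemma exp_neg_mul_log_two_lt {x y : ℝ} (h : x < y) :
    Real.exp (-y * Real.log 2) < Real.exp (-x * Real.log 2) :=
  Real.exp_lt_exp.2 (by nlinarith [Real.log_pos one_lt_two])

/-- Both coordinates of a critical point in the region agree. -/
lemma eq_of_fGrad_eq_zero {n : ℕ} {k l : ℝ} (hk : 0 < k) (hl : 0 < l) (hn : k + l ≤ n)
    (h₁ : fGrad n k l = 0) (h₂ : fGrad n l k = 0) : k = l := by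
  wlog hlt : k < l generalizing k l
  · rcases (not_lt.1 hlt).lt_or_eq with h | h
    · exact (this hl hk (by linarith) h₂ h₁ h).symm
    · exact h.symm
  have hlog := Real.log_lt_log hk hlt
  have hexp := exp_neg_mul_log_two_lt hlt
  have hmul : 0 ≤ ((n : ℝ) - k - l) * Real.log 2 :=
    mul_nonneg (by linarith) (Real.log_pos one_lt_two).le
  have := mul_le_mul_of_nonneg_left hexp.le hmul
  unfold fGrad at h₁ h₂
  linarith

lemma fGrad_diag_lt {n : ℕ} {x y : ℝ} (hx : 0 < x) (hxy : x < y) (hy : y + y ≤ n) :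
    fGrad n y y < fGrad n x x := by
  have hlog := Real.log_lt_log hx hxy
  have hexp := exp_neg_mul_log_two_lt hxy
  have h2 := Real.log_pos one_lt_two
  have hmul : ((n : ℝ) - y - y) * Real.log 2 * Real.exp (-y * Real.log 2) ≤
      ((n : ℝ) - x - x) * Real.log 2 * Real.exp (-x * Real.log 2) := by
    have : 0 ≤ (n : ℝ) - x - x := by linarith
    gcongr
  have := mul_lt_mul_of_pos_right hxy h2
  unfold fGrad
  linarith

/-- The region contains at most one critical point, and it lies on the diagonal. -/
lemma IsCritPt.eq_of_region {n : ℕ} {k l x : ℝ} (hkl : (k, l) ∈ region n)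
    (h : IsCritPt n k l) (hx : (x, x) ∈ region n) (h' : IsCritPt n x x) :
    k = x ∧ l = x := by
  obtain ⟨hk, hl, hn⟩ := hkl
  obtain ⟨hx1, -, hxn⟩ := hx
  dsimp only at *
  rw [isCritPt_iff n (by linarith) (by linarith)] at h h'
  obtain rfl := eq_of_fGrad_eq_zero (by linarith) (by linarith) (by linarith) h.1 h.2
  rcases lt_trichotomy k x with hlt | heq | hlt
  · have := fGrad_diag_lt (n := n) (by linarith) hlt (by linarith)
    linarith [h.1, h'.1]
  · exact ⟨heq, heq⟩
  · have := fGrad_diag_lt (n := n) (by linarith) hlt (by linarith)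
    linarith [h.1, h'.1]

lemma mul_log_tangent {x y : ℝ} (hx : 0 < x) (hy : 0 < y) :
    -(y * Real.log y) + y ≤ -(x * Real.log x) + x - (y - x) * Real.log x := by
  have h := Real.log_le_sub_one_of_pos (div_pos hx hy)
  rw [Real.log_div hx.ne' hy.ne'] at h
  have h1 := mul_le_mul_of_nonneg_left h hy.le
  have h2 : y * (x / y - 1) = x - y := by field_simp
  linarith

/-- The excess `exp y - 1 - y` of the exponential over its tangent at `0`,
evaluated at `y = -a * log 2`. -/
noncomputable def expExcess (a : ℝ) : ℝ := Real.exp (-a * Real.log 2) - 1 + a * Real.log 2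

lemma expExcess_nonneg (a : ℝ) : 0 ≤ expExcess a := by
  have := Real.add_one_le_exp (-a * Real.log 2)
  unfold expExcess
  linarith

lemma sq_div_four_le_exp_sub {y : ℝ} (hy : -2 ≤ y) : y ^ 2 / 4 ≤ Real.exp y - 1 - y := by
  have h := Real.add_one_le_exp (y / 2)
  have h2 : Real.exp y = Real.exp (y / 2) ^ 2 := by
    rw [← Real.exp_nat_mul]
    congr 1
    push_cast
    ring
  nlinarith

lemma expExcess_ge_of_quarter_le_abs {a : ℝ} (ha : 1 / 4 ≤ |a|) : 7 / 1000 ≤ expExcess a := by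
  have h2 := Real.log_two_gt_d9
  have hpos := Real.exp_pos (-a * Real.log 2)
  unfold expExcess
  by_cases hy : -2 ≤ -a * Real.log 2
  · have h := sq_div_four_le_exp_sub hy
    have : (1 / 4 * 0.69) ^ 2 ≤ (-a * Real.log 2) ^ 2 := by
      rw [← sq_abs (-a * Real.log 2), abs_mul, abs_neg, abs_of_pos (by linarith : 0 < Real.log 2)]
      gcongr
      linarith
    norm_num at this
    linarith
  · linarith

lemma expExcess_ge_of_five_le_abs {a : ℝ} (ha : 5 ≤ |a|) : 246 / 100 ≤ expExcess a := by
  have h2 := Real.log_two_gt_d9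
  have hpos := Real.exp_pos (-a * Real.log 2)
  unfold expExcess
  rcases le_abs.1 ha with h | h
  · nlinarith
  · have hy : 5 * 0.693 ≤ -a * Real.log 2 := by
      gcongr
      linarith
    have := sq_div_four_le_exp_sub (y := -a * Real.log 2) (by linarith)
    nlinarith

/-- The drop of `f` from a diagonal critical point. -/
lemma f_sub_le {n : ℕ} {x k l : ℝ} (hx : 0 < x) (hk : 1 ≤ k) (hl : 1 ≤ l)
    (h : fGrad n x x = 0) :
    f n k l - f n x x ≤ -(((n : ℝ) - x - x) * Real.exp (-x * Real.log 2) *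
      (expExcess (k - x) + expExcess (l - x))) + 1 := by
  have h2 := Real.log_two_gt_d9
  have hexp : ∀ y : ℝ, Real.exp (-y * Real.log 2) =
      Real.exp (-x * Real.log 2) * Real.exp (-(y - x) * Real.log 2) := fun y => by
    rw [← Real.exp_add]
    ring_nf
  have hhalf : ∀ y : ℝ, 1 ≤ y → Real.exp (-y * Real.log 2) ≤ 1 / 2 := fun y hy => by
    have : Real.exp (-1 * Real.log 2) = 1 / 2 := by
      rw [neg_one_mul, Real.exp_neg, Real.exp_log two_pos]
      norm_num
    rw [← this]
    gcongr
  have hk' := hhalf k hk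
  have hl' := hhalf l hl
  have tk := mul_log_tangent hx (by linarith : 0 < k)
  have tl := mul_log_tangent hx (by linarith : 0 < l)
  have ek := expExcess_nonneg (k - x)
  have el := expExcess_nonneg (l - x)
  unfold fGrad at h
  unfold f
  unfold expExcess at *
  rw [hexp k] at hk' ⊢
  rw [hexp l] at hl' ⊢
  have hp := Real.exp_pos (-x * Real.log 2)
  set p := Real.exp (-x * Real.log 2)
  set u := Real.exp (-(k - x) * Real.log 2)
  set v := Real.exp (-(l - x) * Real.log 2)
  obtain ⟨s, hs⟩ : ∃ s, s = k + l - 2 * x := ⟨_, rfl⟩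
  have herr : s * (p * (u + v - 2)) - s ^ 2 / 2 * Real.log 2 ≤ 1 := by
    have hsq : s ^ 2 / 2 * 0.69 ≤ s ^ 2 / 2 * Real.log 2 := by
      gcongr
      linarith
    rcases le_total 0 s with h0 | h0
    · have : s * (p * (u + v - 2)) ≤ s * 1 := by
        gcongr
        linarith
      nlinarith [sq_nonneg (s - 1.4)]
    · have huv : 0 ≤ u + v - 2 := by nlinarith
      have := mul_nonneg (neg_nonneg.2 h0) (mul_nonneg hp.le huv)
      nlinarith [sq_nonneg s]
  have hmul : s * (Real.log n - Real.log x - (x + x + 1 / 2) * Real.log 2 + (p + p)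
    + ((n : ℝ) - x - x) * Real.log 2 * p) = 0 := by rw [h, mul_zero]
  subst hs
  linarith

lemma two_mul_add_two_le_rpow {k : ℕ} (hk : 3 ≤ k) :
    2 * (k : ℝ) + 2 ≤ (2 : ℝ) ^ ((k : ℝ) + 1 / 2) := by
  have h : 2 * k + 2 ≤ 2 ^ k := by
    induction k, hk using Nat.le_induction with
    | base => norm_num
    | succ m hm ih =>
      rw [pow_succ]
      omega
  calc 2 * (k : ℝ) + 2 ≤ (2 : ℝ) ^ k := by exact_mod_cast h
    _ = (2 : ℝ) ^ (k : ℝ) := (Real.rpow_natCast 2 k).symm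
    _ ≤ _ := Real.rpow_le_rpow_of_exponent_le one_le_two (by linarith)

/-- Location of the diagonal critical point, for `n` within `1` of `2 ^ (k + 1/2) * k`. -/
lemma exists_fGrad_diag_eq_zero {n : ℕ} {k M : ℝ} (hk : 100 ≤ k) (hM : 2 * k + 2 ≤ M)
    (hlogM : Real.log M = (k + 1 / 2) * Real.log 2) (hn : n ≤ M * k) (hn' : M * k - 1 ≤ n) :
    ∃ x, k + 1 / 4 ≤ x ∧ x ≤ k + 1 / 2 ∧ fGrad n x x = 0 := by
  have h2 := Real.log_two_gt_d9
  have h2' := Real.log_two_lt_d9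
  have hM0 : 0 < M := by linarith
  have hk0 : 0 < k := by linarith
  have hMk : 1000 ≤ M * k := by nlinarith
  have hexp : Real.exp (-(k + 1 / 2) * Real.log 2) = M⁻¹ := by
    rw [neg_mul, ← hlogM, Real.exp_neg, Real.exp_log hM0]
  have hexp' : Real.exp (-(k + 1 / 4) * Real.log 2) = M⁻¹ * Real.exp (Real.log 2 / 4) := by
    rw [← hexp, ← Real.exp_add]
    ring_nf
  have hcont : ContinuousOn (fun x => fGrad n x x) (Set.Icc (k + 1 / 4) (k + 1 / 2)) := by
    unfold fGrad
    have : ∀ x ∈ Set.Icc (k + 1 / 4) (k + 1 / 2), x ≠ 0 := fun x hx => by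
      have := hx.1
      linarith
    fun_prop (disch := assumption)
  have hright : fGrad n (k + 1 / 2) (k + 1 / 2) ≤ 0 := by
    have hL : Real.log n ≤ Real.log M + Real.log k := by
      rw [← Real.log_mul hM0.ne' hk0.ne']
      exact Real.log_le_log (by linarith) hn
    have hlogk : Real.log k ≤ Real.log (k + 1 / 2) := Real.log_le_log hk0 (by linarith)
    have hinv : M⁻¹ ≤ 1 / 100 := by
      rw [one_div]
      exact inv_anti₀ (by norm_num) (by linarith)
    have hmain : ((n : ℝ) - (k + 1 / 2) - (k + 1 / 2)) * Real.log 2 * M⁻¹ ≤ k * Real.log 2 := by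
      rw [← div_eq_mul_inv, div_le_iff₀ hM0]
      nlinarith
    unfold fGrad
    rw [hexp]
    linarith
  have hleft : 0 ≤ fGrad n (k + 1 / 4) (k + 1 / 4) := by
    have hL : Real.log M + Real.log k - Real.log 2 ≤ Real.log n := by
      rw [← Real.log_mul hM0.ne' hk0.ne', ← Real.log_div (by positivity) two_ne_zero]
      exact Real.log_le_log (by positivity) (by linarith)
    have hlogk : Real.log (k + 1 / 4) ≤ Real.log k + Real.log 2 := by
      rw [← Real.log_mul hk0.ne' two_ne_zero]
      exact Real.log_le_log (by linarith) (by linarith)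
    have hr := Real.add_one_le_exp (Real.log 2 / 4)
    have hmain : (k - 1) * Real.log 2 * 1.17 ≤
        ((n : ℝ) - (k + 1 / 4) - (k + 1 / 4)) * Real.log 2 *
          (M⁻¹ * Real.exp (Real.log 2 / 4)) := by
      have h1 : k - 1 ≤ ((n : ℝ) - (k + 1 / 4) - (k + 1 / 4)) * M⁻¹ := by
        rw [← div_eq_mul_inv, le_div_iff₀ hM0]
        nlinarith
      calc (k - 1) * Real.log 2 * 1.17
          ≤ (((n : ℝ) - (k + 1 / 4) - (k + 1 / 4)) * M⁻¹) * Real.log 2 *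
            Real.exp (Real.log 2 / 4) := by
            have h3 : 0 ≤ k - 1 := by linarith
            have h4 := h3.trans h1
            gcongr
            linarith
        _ = _ := by ring
    unfold fGrad
    rw [hexp']
    have : 0 < M⁻¹ * Real.exp (Real.log 2 / 4) := by positivity
    nlinarith
  obtain ⟨x, hx, hx0⟩ := intermediate_value_Icc' (by linarith) hcont ⟨hright, hleft⟩
  exact ⟨x, hx.1, hx.2, hx0⟩

lemma quarter_le_abs_natCast_sub {k : ℕ} {x : ℝ} (h : (k : ℝ) + 1 / 4 ≤ x)
    (h' : x ≤ (k : ℝ) + 1 / 2) (m : ℕ) : 1 / 4 ≤ |(m : ℝ) - x| := by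
  rw [le_abs]
  rcases le_or_gt m k with hm | hm
  · have : (m : ℝ) ≤ k := by exact_mod_cast hm
    right
    linarith
  · have : (k : ℝ) + 1 ≤ m := by exact_mod_cast hm
    left
    linarith

lemma log_le_div_add (k : ℝ) (hk : 0 < k) : Real.log k ≤ k / 32 + 5 / 2 := by
  have h := Real.log_le_sub_one_of_pos (div_pos hk (by norm_num : (0 : ℝ) < 2 ^ 5))
  rw [Real.log_div hk.ne' (by norm_num), Real.log_pow] at h
  have := Real.log_two_lt_d9
  norm_num at h
  linarith

open Classical in
/-- The coordinate of the diagonal critical point of `f n` in the region, `0` if there is none. -/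
noncomputable def critCoord (n : ℕ) : ℝ :=
  if h : ∃ x, (x, x) ∈ region n ∧ IsCritPt n x x then h.choose else 0

lemma critCoord_spec {n : ℕ} (h : ∃ x, (x, x) ∈ region n ∧ IsCritPt n x x) :
    (critCoord n, critCoord n) ∈ region n ∧ IsCritPt n (critCoord n) (critCoord n) := by
  rw [critCoord, dif_pos h]
  exact h.choose_spec

/-- There is a constant `c > 0` such that, for all sufficiently
large `k`, with `n = ⌊2^{k+1/2} k⌋` and `(k*(n), k*(n))` the (unique) critical point
of `f` in the region `R`: for all integers `k̃, l̃ ≥ 1` with `k̃ + l̃ ≤ n − 1` one has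
`f(k̃,l̃) − f(k*,k*) ≤ −c·ln n`, and moreover `f(k̃,l̃) − f(k*,k*) ≤ −3·ln n` whenever
in addition `|k̃ − k*| ≥ 5` or `|l̃ − k*| ≥ 5`. -/
theorem f_drop_on_integers :
    ∃ c : ℝ, 0 < c ∧ ∃ (kstar : ℕ → ℝ) (K : ℕ), ∀ k : ℕ, K ≤ k →
      ∀ n : ℕ, n = ⌊(2 : ℝ) ^ ((k : ℝ) + 1/2) * k⌋₊ →
        ((kstar n, kstar n) ∈ region n ∧ IsCritPt n (kstar n) (kstar n) ∧
          ∀ k' l' : ℝ, (k', l') ∈ region n → IsCritPt n k' l' →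
            k' = kstar n ∧ l' = kstar n) ∧
        ∀ kt lt : ℕ, 1 ≤ kt → 1 ≤ lt → (kt : ℝ) + (lt : ℝ) ≤ (n : ℝ) - 1 →
          (f n kt lt - f n (kstar n) (kstar n) ≤ -c * Real.log n ∧
            ((5 ≤ |(kt : ℝ) - kstar n| ∨ 5 ≤ |(lt : ℝ) - kstar n|) →
              f n kt lt - f n (kstar n) (kstar n) ≤ -3 * Real.log n)) := by
  refine ⟨1 / 1000, by norm_num, critCoord, 1000, ?_⟩
  intro k hk n hn
  have hk' : (1000 : ℝ) ≤ k := by exact_mod_cast hk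
  have hM := two_mul_add_two_le_rpow (k := k) (by omega)
  have hlogM : Real.log ((2 : ℝ) ^ ((k : ℝ) + 1 / 2)) = ((k : ℝ) + 1 / 2) * Real.log 2 :=
    Real.log_rpow two_pos _
  have hn1 : (n : ℝ) ≤ (2 : ℝ) ^ ((k : ℝ) + 1 / 2) * k := by
    rw [hn]
    exact Nat.floor_le (by positivity)
  have hn2 : (2 : ℝ) ^ ((k : ℝ) + 1 / 2) * k - 1 ≤ n := by
    rw [hn]
    exact (Nat.sub_one_lt_floor _).le
  set M := (2 : ℝ) ^ ((k : ℝ) + 1 / 2)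
  have hM0 : 0 < M := by linarith
  obtain ⟨x, hx1, hx2, hx0⟩ :=
    exists_fGrad_diag_eq_zero (by linarith : (100 : ℝ) ≤ k) hM hlogM hn1 hn2
  have hxpos : 0 < x := by linarith
  have hxr : (x, x) ∈ region n := by
    refine ⟨?_, ?_, ?_⟩ <;> dsimp only
    · linarith
    · linarith
    · nlinarith
  have hxc : IsCritPt n x x := (isCritPt_iff n hxpos hxpos).2 ⟨hx0, hx0⟩
  obtain ⟨hr, hc⟩ := critCoord_spec ⟨x, hxr, hxc⟩
  have hcx : critCoord n = x := (hc.eq_of_region hr hxr hxc).1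
  rw [hcx]
  refine ⟨⟨hxr, hxc, fun k' l' h h' => h'.eq_of_region h hxr hxc⟩, ?_⟩
  intro kt lt hkt hlt _
  have h2 := Real.log_two_gt_d9
  have h2' := Real.log_two_lt_d9
  have hL : Real.log n ≤ 0.6932 * (k + 1 / 2) + (k / 32 + 5 / 2) := by
    have hle : Real.log n ≤ Real.log M + Real.log k := by
      rw [← Real.log_mul hM0.ne' (by positivity)]
      exact Real.log_le_log (by nlinarith) hn1
    have := log_le_div_add k (by linarith)
    nlinarith
  have hcoef : (k : ℝ) - 1 ≤ ((n : ℝ) - x - x) * Real.exp (-x * Real.log 2) := by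
    have hexp : M⁻¹ ≤ Real.exp (-x * Real.log 2) := by
      rw [← Real.exp_log hM0, ← Real.exp_neg, hlogM]
      gcongr
      nlinarith
    have hN : ((k : ℝ) - 1) * M ≤ (n : ℝ) - x - x := by nlinarith
    calc (k : ℝ) - 1 = ((k : ℝ) - 1) * M * M⁻¹ := by field_simp
      _ ≤ _ := by
        have : 0 ≤ ((k : ℝ) - 1) * M := mul_nonneg (by linarith) hM0.le
        gcongr
        linarith
  have hdrop : ∀ e, 0 ≤ e → e ≤ expExcess (kt - x) + expExcess (lt - x) →
      f n kt lt - f n x x ≤ -((k - 1) * e) + 1 := fun e he hle => by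
    have h := f_sub_le hxpos (by exact_mod_cast hkt : (1 : ℝ) ≤ kt)
      (by exact_mod_cast hlt : (1 : ℝ) ≤ lt) hx0
    have : ((k : ℝ) - 1) * e ≤ ((n : ℝ) - x - x) * Real.exp (-x * Real.log 2) *
        (expExcess (kt - x) + expExcess (lt - x)) :=
      mul_le_mul hcoef hle he (le_trans (by linarith) hcoef)
    linarith
  have hek := expExcess_nonneg (kt - x)
  have hel := expExcess_nonneg (lt - x)
  constructor
  · have hq := expExcess_ge_of_quarter_le_abs (quarter_le_abs_natCast_sub hx1 hx2 kt)
    have := hdrop (7 / 1000) (by norm_num) (by linarith)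
    linarith
  · intro hfar
    have hq : 246 / 100 ≤ expExcess (kt - x) + expExcess (lt - x) := by
      rcases hfar with h | h
      · linarith [expExcess_ge_of_five_le_abs h]
      · linarith [expExcess_ge_of_five_le_abs h]
    have := hdrop (246 / 100) (by norm_num) hq
    linarith
end

section
/- With n = n_k = 2^k k, the expectation of X(k,k) under G(n_k,1/2) satisfies lim_{k→∞} E X(k,k) = 1/(2π). -/
open Filter Real

theorem Nat.card_simpleGraph (V : Type*) [Finite V] :
    Nat.card (SimpleGraph V) = 2 ^ (Nat.card V).choose 2 := by
  have e : SimpleGraph V ≃ Set ((Sym2.diagSet : Set (Sym2 V))ᶜ : Set (Sym2 V)) :=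
    { toFun := fun G => {e | (e : Sym2 V) ∈ G.edgeSet}
      invFun := fun s => SimpleGraph.fromEdgeSet (Subtype.val '' s)
      left_inv := fun G => by
        ext u v
        simp +contextual
      right_inv := fun s => by
        ext ⟨e, he⟩
        have : ¬ e.IsDiag := he
        simp [this] }
  rw [Nat.card_congr e, Set, Nat.card_fun]
  simp [Nat.card_coe_set_eq, Sym2.ncard_diagSet_compl]

/-- The possible neighborhoods in `X` of a vertex `y`, for a graph in which `X ⊆ U`, the vertex `x`
is adjacent to all of `X` and every vertex outside `U` has a neighbor in `X`. Vertices of `U` are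
assigned the empty set by convention. -/
def nbhdChoices {V : Type*} [DecidableEq V] (U X : Finset V) (x y : V) : Finset (Finset V) :=
  if y ∈ U then {∅} else if y = x then {X} else X.powerset.erase ∅

theorem prod_card_nbhdChoices {V : Type*} [Fintype V] [DecidableEq V] {U X : Finset V} {x : V}
    (hx : x ∉ U) :
    ∏ y, (nbhdChoices U X x y).card = (2 ^ X.card - 1) ^ (Fintype.card V - U.card - 1) := by
  have h : ∀ y, (nbhdChoices U X x y).card =
      if y ∈ Uᶜ.erase x then 2 ^ X.card - 1 else 1 := by
    intro y
    unfold nbhdChoices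
    by_cases h1 : y ∈ U
    · simp [h1]
    · by_cases h2 : y = x
      · simp [h2, hx]
      · simp [h1, h2, Finset.card_erase_of_mem]
  simp_rw [h]
  rw [Finset.prod_ite_mem, Finset.univ_inter, Finset.prod_const,
    Finset.card_erase_of_mem (by simpa using hx), Finset.card_compl]

theorem of_mem_piFinset_nbhdChoices {V : Type*} [Fintype V] [DecidableEq V] {U X : Finset V}
    {x : V} {f : V → Finset V} (hX : X.Nonempty) (hx : x ∉ U)
    (hf : f ∈ Fintype.piFinset (nbhdChoices U X x)) :
    (∀ y ∈ U, f y = ∅) ∧ f x = X ∧ (∀ y, f y ⊆ X) ∧ ∀ y, y ∉ U → (f y).Nonempty := by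
  rw [Fintype.mem_piFinset] at hf
  refine ⟨fun y hy => ?_, ?_, fun y => ?_, fun y hy => ?_⟩
  · simpa [nbhdChoices, hy] using hf y
  · simpa [nbhdChoices, hx] using hf x
  · have := hf y
    unfold nbhdChoices at this
    split_ifs at this <;> simp_all
  · have := hf y
    unfold nbhdChoices at this
    split_ifs at this <;> simp_all [Finset.nonempty_iff_ne_empty]

/-- The graph in which `X₁` and `X₂` are cliques, `y` is joined to `f y` and to `g y`, and which
extends the graph `H` on the complement of `X₁ ∪ X₂`. -/
def configGraph {V : Type*} [DecidableEq V] (X₁ X₂ : Finset V)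
    (H : SimpleGraph {y // y ∉ X₁ ∪ X₂}) (f g : V → Finset V) : SimpleGraph V where
  Adj u v := u ≠ v ∧ ((u ∈ X₁ ∧ v ∈ X₁) ∨ (u ∈ X₂ ∧ v ∈ X₂) ∨ (u ∈ f v ∨ v ∈ f u) ∨
    (u ∈ g v ∨ v ∈ g u) ∨ ∃ hu hv, H.Adj ⟨u, hu⟩ ⟨v, hv⟩)
  symm := ⟨by
    rintro u v ⟨huv, h⟩
    refine ⟨huv.symm, ?_⟩
    rcases h with h | h | h | h | ⟨hu, hv, h⟩
    · tauto
    · tauto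
    · tauto
    · tauto
    · exact Or.inr <| Or.inr <| Or.inr <| Or.inr ⟨hv, hu, h.symm⟩⟩
  loopless := ⟨fun u h => h.1 rfl⟩

open Classical in
/-- A graph with configuration `(X₁, X₂, x)` amounts to an arbitrary graph on the complement of
`X₁ ∪ X₂` and admissible neighborhoods in `X₁` and in `X₂` of the vertices of the complement. -/
noncomputable def configEquiv {n : ℕ} {X₁ X₂ : Finset (Fin n)} {x : Fin n} (h₁ : X₁.Nonempty)
    (h₂ : X₂.Nonempty) (hd : Disjoint X₁ X₂) (hx : x ∉ X₁ ∪ X₂) :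
    {G : SimpleGraph (Fin n) // IsConfig G X₁ X₂ x} ≃
      SimpleGraph {y // y ∉ X₁ ∪ X₂} ×
        ↥(Fintype.piFinset (nbhdChoices (X₁ ∪ X₂) X₁ x)) ×
        ↥(Fintype.piFinset (nbhdChoices (X₁ ∪ X₂) X₂ x)) where
  toFun G := ⟨G.1.comap Subtype.val,
    ⟨fun y => if y ∈ X₁ ∪ X₂ then ∅ else X₁.filter (G.1.Adj y), by
      obtain ⟨G, hG⟩ := G
      rw [Fintype.mem_piFinset]
      intro y
      obtain ⟨-, -, -, -, -, -, -, -, a, b, c⟩ := hG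
      unfold nbhdChoices
      split_ifs with h h'
      · simp
      · subst h'
        simpa [Finset.filter_eq_self] using a
      · have := c y (by grind) (by grind)
        simp only [Finset.mem_erase, Finset.mem_powerset, Finset.filter_subset, and_true]
        exact Finset.nonempty_iff_ne_empty.1 (Finset.filter_nonempty_iff.2 this.1)⟩,
    ⟨fun y => if y ∈ X₁ ∪ X₂ then ∅ else X₂.filter (G.1.Adj y), by
      obtain ⟨G, hG⟩ := G
      rw [Fintype.mem_piFinset]
      intro y
      obtain ⟨-, -, -, -, -, -, -, -, a, b, c⟩ := hG
      unfold nbhdChoices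
      split_ifs with h h'
      · simp
      · subst h'
        simpa [Finset.filter_eq_self] using b
      · have := c y (by grind) (by grind)
        simp only [Finset.mem_erase, Finset.mem_powerset, Finset.filter_subset, and_true]
        exact Finset.nonempty_iff_ne_empty.1 (Finset.filter_nonempty_iff.2 this.2)⟩⟩
  invFun t := ⟨configGraph X₁ X₂ t.1 t.2.1.1 t.2.2.1, by
    obtain ⟨H, ⟨f, hf⟩, ⟨g, hg⟩⟩ := t
    obtain ⟨f1, f2, f3, f4⟩ := of_mem_piFinset_nbhdChoices h₁ hx hf
    obtain ⟨g1, g2, g3, g4⟩ := of_mem_piFinset_nbhdChoices h₂ hx hg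
    rw [Finset.disjoint_left] at hd
    simp only [Finset.mem_union, not_or] at hx f1 f4 g1 g4
    refine ⟨h₁, h₂, Finset.disjoint_left.2 hd, hx.1, hx.2, ?_, ?_, ?_, ?_, ?_, ?_⟩
    · intro u hu v hv huv
      exact ⟨huv, Or.inl ⟨hu, hv⟩⟩
    · intro u hu v hv huv
      exact ⟨huv, Or.inr (Or.inl ⟨hu, hv⟩)⟩
    · rintro u hu v hv ⟨huv, h⟩
      have a1 := f1 u (Or.inl hu)
      have a2 := f1 v (Or.inr hv)
      have a3 := g1 u (Or.inl hu)
      have a4 := g1 v (Or.inr hv)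
      simp only [a1, a2, a3, a4, Finset.notMem_empty, or_self, false_or] at h
      rcases h with h | h | ⟨h, -, -⟩
      · exact hd h.2 hv
      · exact hd hu h.1
      · exact h (Finset.mem_union_left _ hu)
    · intro u hu
      exact ⟨fun h => hx.1 (h ▸ hu), by simp [f2, hu]⟩
    · intro u hu
      exact ⟨fun h => hx.2 (h ▸ hu), by simp [g2, hu]⟩
    · intro y hy1 hy2
      obtain ⟨u, hu⟩ := f4 y ⟨hy1, hy2⟩
      obtain ⟨v, hv⟩ := g4 y ⟨hy1, hy2⟩
      have hu1 := f3 y hu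
      have hv1 := g3 y hv
      exact ⟨⟨u, hu1, fun h => hy1 (h ▸ hu1), by simp [hu]⟩,
        ⟨v, hv1, fun h => hy2 (h ▸ hv1), by simp [hv]⟩⟩⟩
  left_inv := by
    rintro ⟨G, hG⟩
    obtain ⟨-, -, -, -, -, a1, a2, a3, -, -, -⟩ := hG
    ext u v
    have hne : G.Adj u v → u ≠ v := G.ne_of_adj
    have hs : G.Adj u v ↔ G.Adj v u := G.adj_comm u v
    have b1 := a1 u
    have b2 := a2 u
    have b3 := a3 u
    have b4 := a3 v
    simp only [configGraph, SimpleGraph.comap_adj]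
    grind
  right_inv := by
    rintro ⟨H, ⟨f, hf⟩, ⟨g, hg⟩⟩
    obtain ⟨f1, -, f3, -⟩ := of_mem_piFinset_nbhdChoices h₁ hx hf
    obtain ⟨g1, -, g3, -⟩ := of_mem_piFinset_nbhdChoices h₂ hx hg
    rw [Finset.disjoint_left] at hd
    refine Prod.ext ?_ (Prod.ext (Subtype.ext ?_) (Subtype.ext ?_))
    · ext ⟨u, hu⟩ ⟨v, hv⟩
      have hne : H.Adj ⟨u, hu⟩ ⟨v, hv⟩ → u ≠ v := fun h e => h.ne (Subtype.ext e)
      have c1 := @f3 u v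
      have c2 := @f3 v u
      have c3 := @g3 u v
      have c4 := @g3 v u
      simp only [configGraph, SimpleGraph.comap_adj]
      grind
    · funext y
      ext u
      have c1 := @f3 y u
      have c2 := @f1 u
      have c3 := @g1 u
      have c4 := @g3 y u
      simp only [configGraph]
      grind
    · funext y
      ext u
      have c1 := @f3 y u
      have c2 := @f1 u
      have c3 := @g1 u
      have c4 := @g3 y u
      simp only [configGraph]
      grind

theorem card_isConfig {n k : ℕ} (hk : 0 < k) {X₁ X₂ : Finset (Fin n)} {x : Fin n}
    (h₁ : X₁.card = k) (h₂ : X₂.card = k) (hd : Disjoint X₁ X₂) (hx : x ∉ X₁ ∪ X₂) :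
    Nat.card {G : SimpleGraph (Fin n) // IsConfig G X₁ X₂ x} =
      2 ^ (n - 2 * k).choose 2 * (2 ^ k - 1) ^ (2 * (n - 2 * k - 1)) := by
  have hU : (X₁ ∪ X₂).card = 2 * k := by
    rw [Finset.card_union_of_disjoint hd, h₁, h₂, two_mul]
  rw [Nat.card_congr (configEquiv (Finset.card_pos.1 (h₁ ▸ hk))
      (Finset.card_pos.1 (h₂ ▸ hk)) hd hx),
    Nat.card_prod, Nat.card_prod, Nat.card_simpleGraph, Nat.card_eq_fintype_card,
    Nat.card_eq_fintype_card, Nat.card_eq_fintype_card, Fintype.card_coe, Fintype.card_coe]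
  have hY : Fintype.card {y // y ∉ X₁ ∪ X₂} = n - 2 * k := by
    rw [Fintype.card_subtype_compl, Fintype.card_coe, hU, Fintype.card_fin]
  simp only [Fintype.card_piFinset, prod_card_nbhdChoices hx, hY, h₁, h₂, hU,
    Fintype.card_fin]
  rw [two_mul (n - 2 * k - 1), pow_add]

open Classical in
theorem sum_Xcount {n k : ℕ} (hk : 0 < k) :
    ∑ G : SimpleGraph (Fin n), Xcount n k k G =
      n.choose k * ((n - k).choose k * ((n - 2 * k) *
        (2 ^ (n - 2 * k).choose 2 * (2 ^ k - 1) ^ (2 * (n - 2 * k - 1))))) := by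
  set N := 2 ^ (n - 2 * k).choose 2 * (2 ^ k - 1) ^ (2 * (n - 2 * k - 1)) with hN
  have h1 : ∀ G : SimpleGraph (Fin n), Xcount n k k G =
      ∑ t : Finset (Fin n) × Finset (Fin n) × Fin n,
        if t.1.card = k ∧ t.2.1.card = k ∧ IsConfig G t.1 t.2.1 t.2.2 then 1 else 0 := by
    intro G
    rw [Xcount, Nat.card_eq_fintype_card, Fintype.card_subtype, Finset.card_filter]
  have h2 : ∀ t : Finset (Fin n) × Finset (Fin n) × Fin n,
      (∑ G : SimpleGraph (Fin n),
        if t.1.card = k ∧ t.2.1.card = k ∧ IsConfig G t.1 t.2.1 t.2.2 then 1 else 0) =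
      if t.1 ∈ Finset.powersetCard k Finset.univ then
        if t.2.1 ∈ Finset.powersetCard k t.1ᶜ then
          if t.2.2 ∈ (t.1 ∪ t.2.1)ᶜ then N else 0 else 0 else 0 := by
    rintro ⟨X₁, X₂, x⟩
    simp only [Finset.mem_powersetCard, Finset.subset_univ, true_and, Finset.mem_compl,
      Finset.subset_compl_iff_disjoint_left]
    by_cases c1 : X₁.card = k
    swap
    · simp [c1]
    by_cases c2 : X₂.card = k
    swap
    · simp [c2]
    by_cases hd : Disjoint X₁ X₂
    swap
    · simp [IsConfig, hd]
    by_cases hx : x ∈ X₁ ∪ X₂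
    · have : ∀ G, ¬ IsConfig G X₁ X₂ x := by
        rintro G ⟨-, -, -, h, h', -⟩
        simp_all
      simp [this, hx]
    · rw [if_pos c1, if_pos ⟨hd, c2⟩, if_pos hx, hN, ← card_isConfig hk c1 c2 hd hx,
        Nat.card_eq_fintype_card, Fintype.card_subtype, Finset.card_filter]
      simp only [c1, c2, true_and]
  simp_rw [h1]
  rw [Finset.sum_comm]
  simp_rw [h2]
  rw [Fintype.sum_prod_type]
  simp_rw [Fintype.sum_prod_type]
  have h3 : ∀ X₁ ∈ Finset.powersetCard k (Finset.univ : Finset (Fin n)),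
      ∀ X₂ ∈ Finset.powersetCard k X₁ᶜ, (X₁ ∪ X₂)ᶜ.card = n - 2 * k := by
    intro X₁ hX₁ X₂ hX₂
    rw [Finset.mem_powersetCard] at hX₁ hX₂
    rw [Finset.card_compl, Fintype.card_fin, Finset.card_union_of_disjoint
      (Finset.subset_compl_iff_disjoint_left.1 hX₂.1), hX₁.2, hX₂.2, two_mul]
  have h4 : ∀ X₁ ∈ Finset.powersetCard k (Finset.univ : Finset (Fin n)), X₁ᶜ.card = n - k := by
    intro X₁ hX₁
    rw [Finset.mem_powersetCard] at hX₁
    rw [Finset.card_compl, Fintype.card_fin, hX₁.2]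
  have h5 : ∀ {α : Type} [Fintype α] (s : Finset α) (f : α → ℕ),
      (∑ a, if a ∈ s then f a else 0) = ∑ a ∈ s, f a := by
    intro α _ s f
    rw [Finset.sum_ite_mem, Finset.univ_inter]
  calc _ = ∑ X₁ ∈ Finset.powersetCard k (Finset.univ : Finset (Fin n)),
        ∑ X₂ ∈ Finset.powersetCard k X₁ᶜ, ∑ x ∈ (X₁ ∪ X₂)ᶜ, N := by
        rw [← h5 (Finset.powersetCard k Finset.univ)]
        refine Finset.sum_congr rfl fun X₁ _ => ?_
        split_ifs
        · rw [← h5 (Finset.powersetCard k X₁ᶜ)]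
          refine Finset.sum_congr rfl fun X₂ _ => ?_
          split_ifs
          · rw [Finset.sum_ite_mem, Finset.univ_inter]
          · exact Finset.sum_const_zero
        · simp only [Finset.sum_const_zero]
    _ = ∑ X₁ ∈ Finset.powersetCard k (Finset.univ : Finset (Fin n)),
        (n - k).choose k * ((n - 2 * k) * N) := by
        refine Finset.sum_congr rfl fun X₁ hX₁ => ?_
        rw [Finset.sum_congr rfl fun X₂ hX₂ => by rw [Finset.sum_const, h3 X₁ hX₁ X₂ hX₂]]
        rw [Finset.sum_const, Finset.card_powersetCard, h4 X₁ hX₁, smul_eq_mul, smul_eq_mul]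
    _ = _ := by
        rw [Finset.sum_const, Finset.card_powersetCard, Finset.card_univ, Fintype.card_fin,
          smul_eq_mul]

theorem tendsto_descFactorial_div_pow {a : ℕ → ℕ} {n : ℕ → ℕ}
    (h : Tendsto (fun k => (a k : ℝ) ^ 2 / n k) atTop (nhds 0)) (hle : ∀ᶠ k in atTop, a k ≤ n k)
    (hn : ∀ᶠ k in atTop, 0 < n k) :
    Tendsto (fun k => ((n k).descFactorial (a k) : ℝ) / (n k : ℝ) ^ a k) atTop (nhds 1) := by
  have h' : Tendsto (fun k => 1 - (a k : ℝ) ^ 2 / n k) atTop (nhds 1) := by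
    simpa using h.const_sub 1
  refine tendsto_of_tendsto_of_tendsto_of_le_of_le' h' tendsto_const_nhds ?_ ?_
  · filter_upwards [hle, hn] with k hk hk0
    have hn0 : (0 : ℝ) < n k := by exact_mod_cast hk0
    have ha : (a k : ℝ) ≤ n k := by exact_mod_cast hk
    have h1 : ((n k : ℝ) - a k) ^ a k ≤ (n k).descFactorial (a k) := by
      rw [← Nat.cast_sub hk]
      exact_mod_cast (Nat.pow_le_pow_left (by lia) _).trans
        (Nat.pow_sub_le_descFactorial (n k) (a k))
    have h2 := one_add_mul_le_pow (a := -((a k : ℝ) / n k))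
      (by have := (div_le_one hn0).2 ha; linarith) (a k)
    calc 1 - (a k : ℝ) ^ 2 / n k = 1 + a k * -((a k : ℝ) / n k) := by ring
      _ ≤ (1 + -((a k : ℝ) / n k)) ^ a k := h2
      _ = ((n k : ℝ) - a k) ^ a k / (n k : ℝ) ^ a k := by
        rw [← div_pow]; congr 1; field_simp; ring
      _ ≤ _ := by gcongr
  · filter_upwards [hn] with k hk0
    rw [div_le_one (by positivity)]
    exact_mod_cast Nat.descFactorial_le_pow _ _

theorem tendsto_pow_mul_exp_div_factorial_sq :
    Tendsto (fun k : ℕ => (k : ℝ) ^ (2 * k + 1) * exp (-(2 * k)) / (k.factorial : ℝ) ^ 2) atTop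
      (nhds (1 / (2 * π))) := by
  have h := ((Stirling.tendsto_stirlingSeq_sqrt_pi.pow 2).const_mul 2).inv₀ (by positivity)
  rw [Real.sq_sqrt pi_pos.le, ← one_div] at h
  refine h.congr' ?_
  filter_upwards [eventually_gt_atTop 0] with k hk
  have hk' : (0 : ℝ) < k := by exact_mod_cast hk
  have hf : (0 : ℝ) < k.factorial := by exact_mod_cast k.factorial_pos
  rw [Stirling.stirlingSeq, div_pow, mul_pow, Real.sq_sqrt (by positivity), div_pow, ← exp_nat_mul,
    Real.exp_neg, div_pow, ← exp_nat_mul]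
  push_cast
  field_simp
  ring_nf

theorem two_mul_add_one_le_two_pow_mul {k : ℕ} (hk : 2 ≤ k) : 2 * k + 1 ≤ 2 ^ k * k := by
  have : 2 ^ 2 ≤ 2 ^ k := Nat.pow_le_pow_right (by norm_num) hk
  nlinarith

theorem tendsto_one_sub_pow_mul_exp :
    Tendsto (fun k : ℕ => (1 - ((2 : ℝ) ^ k)⁻¹) ^ (2 * (2 ^ k * k - 2 * k - 1)) * exp (2 * k)) atTop
      (nhds 1) := by
  have h0 : Tendsto (fun k : ℕ => (k : ℝ) / 2 ^ k) atTop (nhds 0) := by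
    simpa using tendsto_pow_const_div_const_pow_of_one_lt 1 (one_lt_two (α := ℝ))
  have h1 : Tendsto (fun k : ℕ => 1 / (2 : ℝ) ^ k) atTop (nhds 0) := by
    simpa using tendsto_pow_const_div_const_pow_of_one_lt 0 (one_lt_two (α := ℝ))
  have lo : Tendsto (fun k : ℕ => exp (-4 * ((k : ℝ) / 2 ^ k))) atTop (nhds 1) := by
    simpa using (h0.const_mul (-4)).rexp
  have hi : Tendsto (fun k : ℕ => exp (4 * ((k : ℝ) / 2 ^ k) + 2 * (1 / (2 : ℝ) ^ k))) atTop
      (nhds 1) := by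
    simpa using ((h0.const_mul 4).add (h1.const_mul 2)).rexp
  have key : ∀ᶠ k : ℕ in atTop,
      (1 - ((2 : ℝ) ^ k)⁻¹) ^ (2 * (2 ^ k * k - 2 * k - 1)) * exp (2 * k) =
        exp (2 * (2 ^ k * k - 2 * k - 1) * log (1 - ((2 : ℝ) ^ k)⁻¹) + 2 * k) ∧
      (0 : ℝ) ≤ 2 ^ k * k - 2 * k - 1 ∧ (2 : ℝ) ≤ 2 ^ k := by
    filter_upwards [eventually_ge_atTop 2] with k hk
    have h2 : (2 : ℝ) ≤ 2 ^ k := by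
      simpa using pow_le_pow_right₀ (one_le_two (α := ℝ)) (by lia : 1 ≤ k)
    have hn := two_mul_add_one_le_two_pow_mul hk
    have hn' : (2 * k + 1 : ℝ) ≤ 2 ^ k * k := by exact_mod_cast hn
    have hq : 0 < 1 - ((2 : ℝ) ^ k)⁻¹ := by
      have : ((2 : ℝ) ^ k)⁻¹ ≤ 2⁻¹ := by gcongr
      linarith
    refine ⟨?_, by linarith, h2⟩
    rw [exp_add, mul_comm _ (log _), exp_mul (log _), exp_log hq, ← rpow_natCast, Nat.sub_sub]
    push_cast [Nat.cast_sub hn]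
    rw [sub_sub]
  refine tendsto_of_tendsto_of_tendsto_of_le_of_le' lo hi ?_ ?_
  · filter_upwards [key] with k ⟨h, hm, h2⟩
    rw [h, exp_le_exp]
    set Q : ℝ := 2 ^ k
    have hq : 0 < 1 - Q⁻¹ := by
      have : Q⁻¹ ≤ 2⁻¹ := by gcongr
      linarith
    have hl : -(1 / (Q - 1)) ≤ log (1 - Q⁻¹) := by
      refine le_trans (le_of_eq ?_) (one_sub_inv_le_log_of_pos hq)
      have : Q - 1 ≠ 0 := by linarith
      field_simp
      ring
    have hb : 1 / (Q - 1) ≤ 2 / Q := by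
      rw [div_le_div_iff₀ (by linarith) (by linarith)]; linarith
    have hk : (0 : ℝ) ≤ k := by positivity
    calc -4 * (k / Q) = -(2 * k * (2 / Q)) := by ring
      _ ≤ -(2 * k * (1 / (Q - 1))) := by gcongr
      _ = 2 * (Q * k) * -(1 / (Q - 1)) + 2 * k := by
        have : Q - 1 ≠ 0 := by linarith
        field_simp
        ring
      _ ≤ 2 * (Q * k - 2 * k - 1) * -(1 / (Q - 1)) + 2 * k := by
        have : 0 ≤ 1 / (Q - 1) := by apply one_div_nonneg.2; linarith
        nlinarith
      _ ≤ _ := by gcongr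
  · filter_upwards [key] with k ⟨h, hm, h2⟩
    rw [h, exp_le_exp]
    set Q : ℝ := 2 ^ k
    have hq : 0 < 1 - Q⁻¹ := by
      have : Q⁻¹ ≤ 2⁻¹ := by gcongr
      linarith
    calc _ ≤ 2 * (Q * k - 2 * k - 1) * -Q⁻¹ + 2 * k := by
          gcongr
          linarith [log_le_sub_one_of_pos hq]
      _ = _ := by field_simp; ring

theorem choose_mul_choose_mul_factorial_sq (n k : ℕ) :
    n.choose k * ((n - k).choose k * (n - 2 * k)) * k.factorial ^ 2 =
      n.descFactorial (2 * k + 1) := by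
  have h := Nat.descFactorial_mul_descFactorial (n := n) (show k ≤ 2 * k by lia)
  rw [show 2 * k - k = k by lia] at h
  rw [Nat.descFactorial_succ, ← h, Nat.descFactorial_eq_factorial_mul_choose,
    Nat.descFactorial_eq_factorial_mul_choose]
  ring

theorem choose_two_eq_add {n k : ℕ} (h : 2 * k + 1 ≤ n) :
    n.choose 2 = (n - 2 * k).choose 2 + k * (2 * k + 1) + k * (2 * (n - 2 * k - 1)) := by
  obtain ⟨m, rfl⟩ := Nat.exists_eq_add_of_le h
  rw [show 2 * k + 1 + m - 2 * k = m + 1 by lia, show m + 1 - 1 = m by lia]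
  qify
  rw [Nat.cast_choose_two, Nat.cast_choose_two]
  push_cast
  ring

theorem expect_Xcount_eq {n k : ℕ} (hk : 0 < k) (h : 2 * k + 1 ≤ n) :
    expect n (fun G => (Xcount n k k G : ℝ)) =
      n.descFactorial (2 * k + 1) / ((k.factorial : ℝ) ^ 2 * (2 ^ k) ^ (2 * k + 1)) *
        (1 - ((2 : ℝ) ^ k)⁻¹) ^ (2 * (n - 2 * k - 1)) := by
  have hq : (1 - ((2 : ℝ) ^ k)⁻¹) = (2 ^ k - 1) / 2 ^ k := by field_simp
  have hf : (k.factorial : ℝ) ≠ 0 := by exact_mod_cast k.factorial_ne_zero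
  rw [expect, ← Nat.cast_sum, sum_Xcount hk, choose_two_eq_add h,
    ← choose_mul_choose_mul_factorial_sq, hq, div_pow, pow_add, pow_add, pow_mul 2 k,
    pow_mul 2 k]
  push_cast [Nat.one_le_two_pow]
  field_simp

/-- With `n_k = 2^k k`, `E X(k,k) → 1/(2π)` as `k → ∞`. -/
theorem expect_Xcount_tendsto :
    Tendsto (fun k : ℕ => expect (2 ^ k * k) (fun G => (Xcount (2 ^ k * k) k k G : ℝ)))
      atTop (nhds (1 / (2 * Real.pi))) := by
  have hD : Tendsto (fun k : ℕ => ((2 ^ k * k).descFactorial (2 * k + 1) : ℝ) /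
      ((2 ^ k * k : ℕ) : ℝ) ^ (2 * k + 1)) atTop (nhds 1) := by
    refine tendsto_descFactorial_div_pow ?_ ?_ ?_
    · have h0 : Tendsto (fun k : ℕ => 9 * ((k : ℝ) ^ 1 / 2 ^ k)) atTop (nhds 0) := by
        simpa using
          (tendsto_pow_const_div_const_pow_of_one_lt 1 (one_lt_two (α := ℝ))).const_mul 9
      refine squeeze_zero' (Eventually.of_forall fun k => by positivity) ?_ h0
      filter_upwards [eventually_ge_atTop 1] with k hk
      have hk' : (1 : ℝ) ≤ k := by exact_mod_cast hk
      calc ((2 * k + 1 : ℕ) : ℝ) ^ 2 / (2 ^ k * k : ℕ) ≤ (3 * k : ℝ) ^ 2 / (2 ^ k * k : ℕ) := by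
            gcongr
            push_cast
            linarith
        _ = _ := by
            push_cast
            field_simp
            norm_num
    · filter_upwards [eventually_ge_atTop 2] with k hk using two_mul_add_one_le_two_pow_mul hk
    · filter_upwards [eventually_gt_atTop 0] with k hk using by positivity
  have h := (hD.mul tendsto_pow_mul_exp_div_factorial_sq).mul tendsto_one_sub_pow_mul_exp
  rw [one_mul, mul_one] at h
  refine h.congr' ?_
  filter_upwards [eventually_ge_atTop 2] with k hk
  have hk0 : (k : ℝ) ≠ 0 := by
    have : k ≠ 0 := by lia
    exact_mod_cast this
  rw [expect_Xcount_eq (by lia) (two_mul_add_one_le_two_pow_mul hk), Real.exp_neg]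
  push_cast
  rw [mul_pow]
  field_simp
end
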